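/- Let d≥2, γ>-1, n∈ℕ₀, ξ∈𝕊^{d-1} and (y,s)∈𝕍₀^{d+1} with s>0. Then K_n(ϖ_{-1/2,γ};(ξ,1),(y,s)) = (P_n^{(γ+d/2,(d-2)/2)}(1)/h_n^{(γ+d/2,(d-2)/2)}) · c̃ · ∫_{-1}^1 P_n^{(γ+d/2,(d-2)/2)}(z'(ξ,y,s,v))·(1-v)^{γ+d/2}(1+v)^{(d-2)/2} dv, where z'(ξ,y,s,v) = 1 − (1-v²)(1-⟨ξ,y⟩) − (1/2)(1-v)²(1-s) and c̃ = (∫_{-1}^1 (1-v)^{γ+d/2}(1+v)^{(d-2)/2} dv)^{-1}. -/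

import Mathlib

open MeasureTheory Real Filter Set
open scoped RealInnerProductSpace ENNReal

noncomputable section

/-- Pochhammer symbol `(a)_n = a(a+1)⋯(a+n-1)`. -/
def poch (a : ℝ) (n : ℕ) : ℝ := ∏ i ∈ Finset.range n, (a + i)

/-- Jacobi polynomial `P_n^{(a,b)}(t)` via its hypergeometric expansion. -/
def jacobiP (n : ℕ) (a b : ℝ) (t : ℝ) : ℝ :=
  (poch (a + 1) n / (n.factorial : ℝ)) *
    ∑ j ∈ Finset.range (n + 1),
      (poch (-(n : ℝ)) j * poch ((n : ℝ) + a + b + 1) j) /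
        (poch (a + 1) j * (j.factorial : ℝ)) * ((1 - t) / 2) ^ j

/-- Squared norm `h_n^{(a,b)}` of the Jacobi polynomials. -/
def hJ (n : ℕ) (a b : ℝ) : ℝ :=
  (poch (a + 1) n * poch (b + 1) n * (a + b + (n : ℝ) + 1)) /
    ((n.factorial : ℝ) * poch (a + b + 2) n * (a + b + 2 * (n : ℝ) + 1))

/-- Normalization constant `c_{a,b}` of the Jacobi weight. -/
def cJ (a b : ℝ) : ℝ := Real.Gamma (a + b + 2) / (Real.Gamma (a + 1) * Real.Gamma (b + 1))

/-- Generalized binomial coefficient `C(n+δ, n) = (δ+1)_n/n!`. -/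
def binomC (δ : ℝ) (n : ℕ) : ℝ := poch (δ + 1) n / (n.factorial : ℝ)

/-- The parabolic domain `𝕌 = {(x₁,x₂) : x₁² ≤ x₂ ≤ 1}`. -/
def Udom : Set (ℝ × ℝ) := {x | x.1 ^ 2 ≤ x.2 ∧ x.2 ≤ 1}

/-- The curved part `𝕌₀` of the boundary of `𝕌`. -/
def Udom0 : Set (ℝ × ℝ) := {x ∈ Udom | x.2 = x.1 ^ 2}

/-- The weight `U_{a,b}` on the parabolic domain. -/
def Uw (a b : ℝ) (x : ℝ × ℝ) : ℝ := (1 - x.2) ^ a * (x.2 - x.1 ^ 2) ^ (b - 1/2)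

/-- Normalization constant `d_{a,b}` of `U_{a,b}`. -/
def dU (a b : ℝ) : ℝ := (∫ x in Udom, Uw a b x)⁻¹

/-- The weighted measure `U_{a,b}(x) dx` on `𝕌`. -/
def μU (a b : ℝ) : Measure (ℝ × ℝ) :=
  (volume.restrict Udom).withDensity fun x => ENNReal.ofReal (Uw a b x)

/-- The orthogonal basis `P_{k,n}^{a,b}` on the parabolic domain (with the continuous
extension to `x₂ = 0`, where in Lean `x₁/√x₂ = 0` and `(√x₂)^k = 0` for `k ≥ 1`). -/
def PknU (a b : ℝ) (k n : ℕ) (x : ℝ × ℝ) : ℝ :=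
  jacobiP (n - k) (b + (k : ℝ)) a (1 - 2 * x.2) * (Real.sqrt x.2) ^ k *
    jacobiP k (b - 1/2) (b - 1/2) (x.1 / Real.sqrt x.2)

/-- Squared norms `h_{k,n}^{a,b}`. -/
def hknU (a b : ℝ) (k n : ℕ) : ℝ :=
  (cJ b a / cJ (b + (k : ℝ)) a) * hJ (n - k) (b + (k : ℝ)) a * hJ k (b - 1/2) (b - 1/2)

/-- Reproducing kernel `P_n(U_{a,b}; x, y)` on the parabolic domain. -/
def PnU (a b : ℝ) (n : ℕ) (x y : ℝ × ℝ) : ℝ :=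
  ∑ k ∈ Finset.range (n + 1), PknU a b k n x * PknU a b k n y / hknU a b k n

/-- Partial-sum kernel `K_n(U_{a,b}; x, y)`. -/
def KnU (a b : ℝ) (n : ℕ) (x y : ℝ × ℝ) : ℝ :=
  ∑ m ∈ Finset.range (n + 1), PnU a b m x y

/-- Cesàro `(C,δ)` kernel `K_n^δ(U_{a,b}; x, y)`. -/
def KnUCes (a b δ : ℝ) (n : ℕ) (x y : ℝ × ℝ) : ℝ :=
  (binomC δ n)⁻¹ * ∑ m ∈ Finset.range (n + 1), binomC (δ - 1) (n - m) * KnU a b m x y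

/-- Cesàro `(C,δ)` means `S_n^δ(U_{a,b}; f, x)`. -/
def SnUCes (a b δ : ℝ) (n : ℕ) (f : ℝ × ℝ → ℝ) (x : ℝ × ℝ) : ℝ :=
  dU a b * ∫ y in Udom, f y * KnUCes a b δ n x y * Uw a b y

/-- `Z_m^λ`, the normalized Gegenbauer polynomial (`2T_m` in the limiting case `λ = 0`). -/
def Zm (lam : ℝ) (m : ℕ) (t : ℝ) : ℝ :=
  if lam = 0 then (if m = 0 then 1 else 2 * (Polynomial.Chebyshev.T ℝ (m : ℤ)).eval t)
  else ((m : ℝ) + lam) / lam * (poch (2 * lam) m / poch (lam + 1/2) m) *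
    jacobiP m (lam - 1/2) (lam - 1/2) t

/-- Euclidean space `ℝ^d`. -/
abbrev Euc (d : ℕ) := EuclideanSpace ℝ (Fin d)

/-- The surface measure on the unit sphere `𝕊^{d-1}`. -/
def sphMeas (d : ℕ) : Measure (Metric.sphere (0 : Euc d) 1) :=
  (volume : Measure (Euc d)).toSphere

/-- The surface area `ω_d` of the unit sphere. -/
def ωd (d : ℕ) : ℝ := (sphMeas d Set.univ).toReal

/-- Integral over the unit sphere. -/
def sphInt (d : ℕ) (f : Euc d → ℝ) : ℝ := ∫ ξ, f (ξ : Euc d) ∂(sphMeas d)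

/-- Integral over the surface of the paraboloid `𝕍₀^{d+1}`:
`∫_{𝕍₀} f dσ = ∫_0^1 t^{(d-1)/2} ∫_{𝕊^{d-1}} f(√t ξ, t) dσ_𝕊(ξ) dt`. -/
def V0Int (d : ℕ) (f : Euc d → ℝ → ℝ) : ℝ :=
  ∫ t in (0:ℝ)..1, t ^ (((d : ℝ) - 1) / 2) * ∫ ξ, f (Real.sqrt t • (ξ : Euc d)) t ∂(sphMeas d)

/-- The weight `ϖ_{β,γ}(t) = t^β (1-t)^γ`. -/
def wt (β γ : ℝ) (t : ℝ) : ℝ := t ^ β * (1 - t) ^ γ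

/-- Normalization constant `b_{β,γ}` on the surface of the paraboloid. -/
def bV0 (d : ℕ) (β γ : ℝ) : ℝ := (V0Int d fun _ t => wt β γ t)⁻¹

/-- The surface of the paraboloid `𝕍₀^{d+1} = {(x,t) : ‖x‖² = t ≤ 1}`. -/
def V0set (d : ℕ) : Set (Euc d × ℝ) := {q | ‖q.1‖ ^ 2 = q.2 ∧ q.2 ≤ 1}

/-- The weighted measure `ϖ_{β,γ} dσ` on (the sphere-parametrization of) `𝕍₀^{d+1}`. -/
def μV0 (d : ℕ) (β γ : ℝ) : Measure (Metric.sphere (0 : Euc d) 1 × ℝ) :=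
  ((sphMeas d).prod (volume.restrict (Set.Icc (0:ℝ) 1))).withDensity
    fun p => ENNReal.ofReal (p.2 ^ (((d : ℝ) - 1) / 2) * wt β γ p.2)

/-- Squared norms `h_{m,n}^{β,γ}` on the surface of the paraboloid. -/
def hV0 (d : ℕ) (β γ : ℝ) (m n : ℕ) : ℝ :=
  (cJ (β + ((d : ℝ) - 1) / 2) γ / cJ ((m : ℝ) + β + ((d : ℝ) - 1) / 2) γ) *
    hJ (n - m) ((m : ℝ) + β + ((d : ℝ) - 1) / 2) γ

/-- The reproducing kernel `P_n(ϖ_{β,γ}; (√t ξ, t), (√s η, s))` on `𝕍₀^{d+1}`,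
written as a function of `t`, `s` and `c = ⟨ξ,η⟩`. -/
def PnV0 (d : ℕ) (β γ : ℝ) (n : ℕ) (t s c : ℝ) : ℝ :=
  ∑ m ∈ Finset.range (n + 1),
    jacobiP (n - m) ((m : ℝ) + β + ((d : ℝ) - 1) / 2) γ (1 - 2 * t) *
      jacobiP (n - m) ((m : ℝ) + β + ((d : ℝ) - 1) / 2) γ (1 - 2 * s) / hV0 d β γ m n *
      (Real.sqrt t) ^ m * (Real.sqrt s) ^ m * Zm (((d : ℝ) - 2) / 2) m c

/-- Partial-sum kernel `K_n(ϖ_{β,γ})` on `𝕍₀^{d+1}`. -/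
def KnV0 (d : ℕ) (β γ : ℝ) (n : ℕ) (t s c : ℝ) : ℝ :=
  ∑ m ∈ Finset.range (n + 1), PnV0 d β γ m t s c

/-- Cesàro `(C,δ)` kernel on `𝕍₀^{d+1}`. -/
def KnV0Ces (d : ℕ) (β γ δ : ℝ) (n : ℕ) (t s c : ℝ) : ℝ :=
  (binomC δ n)⁻¹ * ∑ m ∈ Finset.range (n + 1), binomC (δ - 1) (n - m) * KnV0 d β γ m t s c

/-- Cesàro `(C,δ)` means `S_n^δ(ϖ_{β,γ}; f, (√t ξ, t))` on `𝕍₀^{d+1}`. -/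
def SnV0Ces (d : ℕ) (β γ δ : ℝ) (n : ℕ) (f : Euc d × ℝ → ℝ) (ξ : Euc d) (t : ℝ) : ℝ :=
  bV0 d β γ * ∫ s in (0:ℝ)..1, s ^ (((d : ℝ) - 1) / 2) * wt β γ s *
    ∫ η, f (Real.sqrt s • (η : Euc d), s) * KnV0Ces d β γ δ n t s ⟪ξ, (η : Euc d)⟫ ∂(sphMeas d)

/-- Normalization constant `τ_β` in the definition of `T_{β,γ}`. -/
def τβ (d : ℕ) (β : ℝ) : ℝ :=
  (∫ z₁ in (-1:ℝ)..1, ∫ z₂ in (-1:ℝ)..1,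
    (1 - z₁) ^ (((d : ℝ) - 2) / 2) * (1 + z₁) ^ (β - 1/2) * (1 - z₂ ^ 2) ^ β)⁻¹

/-- The operator `T_{β,γ}` on the surface of the paraboloid, with
`(x,t) = (√t ξ, t)` and `(y,s) = (√s η, s)`. -/
def TV0 (d : ℕ) (β γ : ℝ) (g : ℝ × ℝ → ℝ × ℝ → ℝ) (ξ η : Euc d) (t s : ℝ) : ℝ :=
  if β = -(1/2) then g (Real.sqrt t, t) (⟪ξ, Real.sqrt s • η⟫, s)
  else τβ d β * ∫ z₁ in (-1:ℝ)..1, ∫ z₂ in (-1:ℝ)..1,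
    g (Real.sqrt t, t) (Real.sqrt s * ((1 - z₁) / 2 * ⟪ξ, η⟫ + (1 + z₁) / 2 * z₂), s) *
      ((1 - z₁) ^ (((d : ℝ) - 2) / 2) * (1 + z₁) ^ (β - 1/2) * (1 - z₂ ^ 2) ^ β)

/-- The pseudo convolution `f ∗_{𝕍₀} g` on the surface of the paraboloid. -/
def convV0 (d : ℕ) (β γ : ℝ) (f : Euc d × ℝ → ℝ) (g : ℝ × ℝ → ℝ × ℝ → ℝ)
    (η : Euc d) (s : ℝ) : ℝ :=
  bV0 d β γ * ∫ t in (0:ℝ)..1, t ^ (((d : ℝ) - 1) / 2) * wt β γ t *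
    ∫ ξ, f (Real.sqrt t • (ξ : Euc d), t) * TV0 d β γ g (ξ : Euc d) η t s ∂(sphMeas d)

/-- The solid paraboloid `𝕍^{d+1} = {(x,t) : ‖x‖² ≤ t ≤ 1}`. -/
def Vset (d : ℕ) : Set (Euc d × ℝ) := {q | ‖q.1‖ ^ 2 ≤ q.2 ∧ q.2 ≤ 1}

/-- The weight `W_{β,γ,μ}` on the solid paraboloid. -/
def WW (d : ℕ) (β γ μ : ℝ) (q : Euc d × ℝ) : ℝ :=
  q.2 ^ β * (1 - q.2) ^ γ * (q.2 - ‖q.1‖ ^ 2) ^ (μ - 1/2)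

/-- Normalization constant `b_{β,γ,μ}`. -/
def bW (d : ℕ) (β γ μ : ℝ) : ℝ := (∫ q in Vset d, WW d β γ μ q)⁻¹

/-- The weighted measure `W_{β,γ,μ}(x,t) dx dt` on `𝕍^{d+1}`. -/
def μW (d : ℕ) (β γ μ : ℝ) : Measure (Euc d × ℝ) :=
  (volume.restrict (Vset d)).withDensity fun q => ENNReal.ofReal (WW d β γ μ q)

/-- The weight `ϖ_μ(y) = (1-‖y‖²)^{μ-1/2}` on the unit ball. -/
def wB (d : ℕ) (μ : ℝ) (y : Euc d) : ℝ := (1 - ‖y‖ ^ 2) ^ (μ - 1/2)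

/-- Normalization constant `b_μ` of `ϖ_μ` on the unit ball. -/
def bB (d : ℕ) (μ : ℝ) : ℝ := (∫ y in Metric.closedBall (0 : Euc d) 1, wB d μ y)⁻¹

/-- Normalization constant `σ_μ = (∫_{-1}^1 (1-u²)^{μ-1} du)⁻¹`. -/
def σμ (μ : ℝ) : ℝ := (∫ u in (-1:ℝ)..1, (1 - u ^ 2) ^ (μ - 1))⁻¹

/-- `ξ₀(x,t,y,s;u) = (⟨x,y⟩ + u √(t-‖x‖²) √(s-‖y‖²))/√(st)`. -/
def xi0 (d : ℕ) (x : Euc d) (t : ℝ) (y : Euc d) (s : ℝ) (u : ℝ) : ℝ :=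
  (⟪x, y⟫ + u * Real.sqrt (t - ‖x‖ ^ 2) * Real.sqrt (s - ‖y‖ ^ 2)) / Real.sqrt (s * t)

/-- Squared norms `h_{m,n}^{β,γ,μ}` on the solid paraboloid. -/
def hW (d : ℕ) (β γ μ : ℝ) (m n : ℕ) : ℝ :=
  (cJ (β + μ + ((d : ℝ) - 1) / 2) γ / cJ ((m : ℝ) + β + μ + ((d : ℝ) - 1) / 2) γ) *
    hJ (n - m) ((m : ℝ) + β + μ + ((d : ℝ) - 1) / 2) γ

/-- The reproducing kernel `P_n(W_{β,γ,μ}; (x,t), (y,s))` on the solid paraboloid. -/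
def PnW (d : ℕ) (β γ μ : ℝ) (n : ℕ) (x : Euc d) (t : ℝ) (y : Euc d) (s : ℝ) : ℝ :=
  σμ μ * ∫ u in (-1:ℝ)..1,
    (∑ m ∈ Finset.range (n + 1),
      jacobiP (n - m) ((m : ℝ) + β + μ + ((d : ℝ) - 1) / 2) γ (1 - 2 * t) *
        jacobiP (n - m) ((m : ℝ) + β + μ + ((d : ℝ) - 1) / 2) γ (1 - 2 * s) / hW d β γ μ m n *
        (Real.sqrt t) ^ m * (Real.sqrt s) ^ m *
        Zm (μ + ((d : ℝ) - 1) / 2) m (xi0 d x t y s u)) * (1 - u ^ 2) ^ (μ - 1)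

/-- Partial-sum kernel `K_n(W_{β,γ,μ})`. -/
def KnW (d : ℕ) (β γ μ : ℝ) (n : ℕ) (x : Euc d) (t : ℝ) (y : Euc d) (s : ℝ) : ℝ :=
  ∑ m ∈ Finset.range (n + 1), PnW d β γ μ m x t y s

/-- Cesàro `(C,δ)` kernel on the solid paraboloid. -/
def KnWCes (d : ℕ) (β γ μ δ : ℝ) (n : ℕ) (x : Euc d) (t : ℝ) (y : Euc d) (s : ℝ) : ℝ :=
  (binomC δ n)⁻¹ * ∑ m ∈ Finset.range (n + 1), binomC (δ - 1) (n - m) * KnW d β γ μ m x t y s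

/-- Cesàro `(C,δ)` means `S_n^δ(W_{β,γ,μ}; f, (x,t))`. -/
def SnWCes (d : ℕ) (β γ μ δ : ℝ) (n : ℕ) (f : Euc d × ℝ → ℝ) (x : Euc d) (t : ℝ) : ℝ :=
  bW d β γ μ * ∫ q in Vset d, f q * KnWCes d β γ μ δ n x t q.1 q.2 * WW d β γ μ q

/-- `ξ(x,t,y,s;z,u)` in the connection kernel on the solid paraboloid. -/
def ξW (d : ℕ) (x : Euc d) (t : ℝ) (y : Euc d) (s : ℝ) (z₁ z₂ u : ℝ) : ℝ :=
  (1 - z₁) / 2 * xi0 d x t y s u + (1 + z₁) / 2 * z₂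

/-- Normalization constant `κ_β`. -/
def κβ (d : ℕ) (β μ : ℝ) : ℝ :=
  (∫ z₁ in (-1:ℝ)..1, ∫ z₂ in (-1:ℝ)..1, ∫ u in (-1:ℝ)..1,
    (1 - z₁) ^ (μ + ((d : ℝ) - 1) / 2) * (1 + z₁) ^ (β - 1) * (1 - z₂ ^ 2) ^ (β - 1/2) *
      (1 - u ^ 2) ^ (μ - 1))⁻¹

/-- The operator `T_{β,γ,μ}` on the solid paraboloid. -/
def TW (d : ℕ) (β γ μ : ℝ) (g : ℝ × ℝ → ℝ × ℝ → ℝ) (x : Euc d) (t : ℝ) (y : Euc d) (s : ℝ) : ℝ :=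
  if β = 0 then
    σμ μ * ∫ u in (-1:ℝ)..1,
      g (Real.sqrt t, t) (Real.sqrt s * xi0 d x t y s u, s) * (1 - u ^ 2) ^ (μ - 1)
  else
    κβ d β μ * ∫ z₁ in (-1:ℝ)..1, ∫ z₂ in (-1:ℝ)..1, ∫ u in (-1:ℝ)..1,
      g (Real.sqrt t, t) (Real.sqrt s * ξW d x t y s z₁ z₂ u, s) *
        ((1 - z₁) ^ (μ + ((d : ℝ) - 1) / 2) * (1 + z₁) ^ (β - 1) * (1 - z₂ ^ 2) ^ (β - 1/2) *
          (1 - u ^ 2) ^ (μ - 1))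

/-- Directional derivative `⟨x,∇⟩f(x) = ∑ xᵢ ∂ᵢ f(x)`. -/
def xGrad (d : ℕ) (f : Euc d → ℝ) (x : Euc d) : ℝ := fderiv ℝ f x x

/-- Laplacian `Δf(x) = ∑ ∂ᵢ² f(x)`. -/
def lapl (d : ℕ) (f : Euc d → ℝ) (x : Euc d) : ℝ :=
  ∑ i : Fin d, fderiv ℝ (fun y => fderiv ℝ f y (EuclideanSpace.single i 1)) x
    (EuclideanSpace.single i 1)


/-- `Q_{m,n}(x,t) = P_{n-m}^{(m+α,γ)}(1-2t) t^{m/2} Y(x/√t)`. -/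
def QV0gen (d : ℕ) (α γ : ℝ) (m n : ℕ) (Y : Euc d → ℝ) (x : Euc d) (t : ℝ) : ℝ :=
  jacobiP (n - m) ((m : ℝ) + α) γ (1 - 2 * t) * (Real.sqrt t) ^ m * Y ((Real.sqrt t)⁻¹ • x)

end

theorem poch_zero (a : ℝ) : poch a 0 = 1 := by simp [poch]
theorem poch_succ (a : ℝ) (n : ℕ) : poch a (n+1) = poch a n * (a + n) := by
  simp [poch, Finset.prod_range_succ]
theorem poch_succ_left (a : ℝ) (n : ℕ) : poch a (n+1) = a * poch (a+1) n := by
  simp only [poch, Finset.prod_range_succ']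
  rw [mul_comm]; congr 1
  · simp
  · apply Finset.prod_congr rfl; intros; push_cast; ring
theorem poch_add (a : ℝ) (m n : ℕ) : poch a (m+n) = poch a m * poch (a+m) n := by
  simp only [poch, Finset.prod_range_add]
  congr 1; apply Finset.prod_congr rfl; intros; push_cast; ring
theorem poch_pos {a : ℝ} (h : 0 < a) (n : ℕ) : 0 < poch a n :=
  Finset.prod_pos fun i _ => by positivity
/-- `(-k)_j` for j ≤ k -/
theorem poch_neg_nat (k j : ℕ) (h : j ≤ k) :
    poch (-(k:ℝ)) j = (-1)^j * k.factorial / (k-j).factorial := by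
  induction j with
  | zero => simp [poch_zero, div_self, Nat.factorial_ne_zero]
  | succ j ih =>
    rw [poch_succ, ih (by omega)]
    obtain ⟨r, rfl⟩ := Nat.exists_eq_add_of_le h
    have e1 : j + 1 + r - j = r + 1 := by omega
    have e2 : j + 1 + r - (j+1) = r := by omega
    rw [e1, e2, Nat.factorial_succ r]
    have := Nat.factorial_ne_zero r
    push_cast
    field_simp
    ring

/-- normalized Pochhammer -/
noncomputable def ww (a : ℝ) (k : ℕ) : ℝ := poch a k / (k.factorial : ℝ)

theorem ww_zero (a : ℝ) : ww a 0 = 1 := by simp [ww, poch_zero]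
theorem ww_succ (a : ℝ) (k : ℕ) : (k+1) * ww a (k+1) = (a + k) * ww a k := by
  unfold ww
  rw [poch_succ, Nat.factorial_succ]
  have := Nat.factorial_ne_zero k
  push_cast
  field_simp
theorem ww_succ_left (a : ℝ) (k : ℕ) : (k+1) * ww a (k+1) = a * ww (a+1) k := by
  unfold ww
  rw [poch_succ_left, Nat.factorial_succ]
  have := Nat.factorial_ne_zero k
  push_cast
  field_simp
theorem ww_shift (a : ℝ) (k : ℕ) : a * ww (a+1) k = (a + k) * ww a k := by
  rw [← ww_succ_left, ww_succ]
theorem ww_pascal (a : ℝ) (k : ℕ) : ww (a+1) (k+1) = ww a (k+1) + ww (a+1) k := by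
  have h1 := ww_succ (a+1) k
  have h2 := ww_succ_left a k
  have : ((k:ℝ)+1) ≠ 0 := by positivity
  apply mul_left_cancel₀ this
  rw [h1, mul_add, h2]; ring

/-- the series `(1-r)^{-a}` -/
noncomputable def pw (a : ℝ) : PowerSeries ℝ := PowerSeries.mk (ww a)

theorem coeff_pw (a : ℝ) (k : ℕ) : PowerSeries.coeff k (pw a) = ww a k := by simp [pw]

theorem vander (a b : ℝ) (n : ℕ) :
    ∑ p ∈ Finset.HasAntidiagonal.antidiagonal n, ww a p.1 * ww b p.2 = ww (a+b) n := by
  induction n generalizing a b with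
  | zero => simp [ww_zero]
  | succ n ih =>
    have hn : ((n:ℝ)+1) ≠ 0 := by positivity
    apply mul_left_cancel₀ hn
    rw [ww_succ_left]
    have key : ((n:ℝ)+1) * ∑ p ∈ Finset.HasAntidiagonal.antidiagonal (n+1), ww a p.1 * ww b p.2
      = ∑ p ∈ Finset.HasAntidiagonal.antidiagonal (n+1), ((p.1:ℝ) * ww a p.1) * ww b p.2
        + ∑ p ∈ Finset.HasAntidiagonal.antidiagonal (n+1), ww a p.1 * ((p.2:ℝ) * ww b p.2) := by
      rw [Finset.mul_sum, ← Finset.sum_add_distrib]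
      apply Finset.sum_congr rfl
      intro p hp
      have : p.1 + p.2 = n + 1 := by simpa using hp
      have : (p.1:ℝ) + p.2 = n + 1 := by exact_mod_cast this
      rw [← this]; ring
    rw [key, Finset.Nat.sum_antidiagonal_succ, Finset.Nat.sum_antidiagonal_succ']
    simp only [Nat.cast_zero, zero_mul, mul_zero, zero_add, add_zero, Nat.cast_add, Nat.cast_one,
      ww_succ_left]
    have e1 : ∑ p ∈ Finset.HasAntidiagonal.antidiagonal n, a * ww (a+1) p.1 * ww b p.2 = a * ww (a+1+b) n := by
      rw [← ih, Finset.mul_sum]; apply Finset.sum_congr rfl; intros; ring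
    have e2 : ∑ p ∈ Finset.HasAntidiagonal.antidiagonal n, ww a p.1 * (b * ww (b+1) p.2) = b * ww (a+(b+1)) n := by
      rw [← ih, Finset.mul_sum]; apply Finset.sum_congr rfl; intros; ring
    rw [e1, e2, show a+1+b = a+b+1 by ring, show a+(b+1) = a+b+1 by ring]; ring

theorem pw_mul (a b : ℝ) : pw a * pw b = pw (a+b) := by
  ext n
  simp [PowerSeries.coeff_mul, coeff_pw, vander]

noncomputable def pws (s a : ℝ) : PowerSeries ℝ := PowerSeries.rescale s (pw a)
theorem pws_mul (s a b : ℝ) : pws s a * pws s b = pws s (a+b) := by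
  unfold pws; rw [← map_mul, pw_mul]
theorem coeff_pws (s a : ℝ) (k : ℕ) : PowerSeries.coeff k (pws s a) = s^k * ww a k := by
  simp [pws, coeff_pw]

theorem eq_of_deriv {f g h : ℝ → ℝ} (hf : ∀ u, HasDerivAt f (h u) u)
    (hg : ∀ u, HasDerivAt g (h u) u) (u0 : ℝ) (h0 : f u0 = g u0) (u : ℝ) : f u = g u := by
  have hd : ∀ u, HasDerivAt (fun x => f x - g x) 0 u := fun u => by
    simpa using (hf u).fun_sub (hg u)
  have := is_const_of_deriv_eq_zero (f := fun x => f x - g x)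
    (fun x => (hd x).differentiableAt) (fun x => (hd x).deriv) u u0
  simp only [h0, sub_self] at this
  linarith

/-- polynomial form of Jacobi polynomials -/
noncomputable def QQ (k : ℕ) (α B s : ℝ) : ℝ :=
  ∑ j ∈ Finset.range (k+1), (-1)^j * ww (α+1+j) (k-j) * ww B j * s^j

theorem jacobi_eq_QQ (k : ℕ) (a b s : ℝ) (ha : -1 < a) :
    jacobiP k a b (1 - 2*s) = QQ k a (k+a+b+1) s := by
  unfold jacobiP QQ
  rw [Finset.mul_sum]
  apply Finset.sum_congr rfl
  intro j hj
  have hj : j ≤ k := by simpa [Nat.lt_succ_iff] using hj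
  rw [poch_neg_nat k j hj]
  obtain ⟨r, rfl⟩ := Nat.exists_eq_add_of_le hj
  rw [poch_add (a+1) j r]
  have h1 : poch (a+1) j ≠ 0 := (poch_pos (by linarith) j).ne'
  have e2 : j + r - j = r := by omega
  rw [e2]; unfold ww
  have := Nat.factorial_ne_zero r
  have := Nat.factorial_ne_zero (j+r)
  have := Nat.factorial_ne_zero j
  field_simp
  ring

theorem QQ_coeff (k : ℕ) (α B s : ℝ) :
    (-1)^k * QQ k α B s = PowerSeries.coeff k (pws s B * pw (-(k+α))) := by
  rw [PowerSeries.coeff_mul, Finset.Nat.sum_antidiagonal_eq_sum_range_succ_mk, QQ, Finset.mul_sum]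
  apply Finset.sum_congr rfl
  intro j hj
  have hj : j ≤ k := by simpa [Nat.lt_succ_iff] using hj
  obtain ⟨r, rfl⟩ := Nat.exists_eq_add_of_le hj
  have e2 : j + r - j = r := by omega
  rw [coeff_pws, coeff_pw, e2]
  have : ww (-((j+r:ℕ)+α)) r = (-1)^r * ww (α+1+j) r := by
    unfold ww
    have : poch (-((j+r:ℕ)+α)) r = (-1)^r * poch (α+1+j) r := by
      unfold poch
      have hr : (-1:ℝ)^r = ∏ _i ∈ Finset.range r, (-1:ℝ) := by simp
      rw [← Finset.prod_range_reflect, hr, ← Finset.prod_mul_distrib]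
      apply Finset.prod_congr rfl
      intro i hi
      have hi : i < r := by simpa using hi
      have : ((r - 1 - i : ℕ):ℝ) = r - 1 - i := by
        rw [Nat.cast_sub (by omega), Nat.cast_sub (by omega)]; simp
      rw [this]; push_cast; ring
    rw [this]; ring
  rw [this, pow_add]
  have : ((-1:ℝ)^j)*(-1)^j = 1 := by rw [← mul_pow]; simp
  linear_combination (s ^ j * ww B j * ((-1) ^ r * ww (α + 1 + ↑j) r)) * this

theorem QQ_one (k : ℕ) (α B : ℝ) : QQ k α B 1 = (-1)^k * ww (B - α - k) k := by
  have := QQ_coeff k α B 1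
  have e : pws 1 B = pw B := by simp [pws]
  rw [e, pw_mul, coeff_pw] at this
  have h : ((-1:ℝ)^k)*(-1)^k = 1 := by rw [← mul_pow]; simp
  rw [show B - α - k = B + -(k+α) by ring, ← this, ← mul_assoc, h, one_mul]

theorem QQ_deriv (k : ℕ) (α B s : ℝ) :
    HasDerivAt (QQ (k+1) α B) (-B * QQ k (α+1) (B+1) s) s := by
  unfold QQ
  have : ∀ j ∈ Finset.range (k+1+1), HasDerivAt
     (fun s : ℝ => (-1)^j * ww (α+1+j) (k+1-j) * ww B j * s^j)
     ((-1)^j * ww (α+1+j) (k+1-j) * ww B j * (j * s^(j-1))) s := fun j _ =>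
    (hasDerivAt_pow j s).const_mul _
  have := HasDerivAt.fun_sum this
  refine this.congr_deriv ?_
  rw [Finset.sum_range_succ', Finset.mul_sum]
  simp only [Nat.cast_zero, zero_mul, mul_zero, add_zero]
  apply Finset.sum_congr rfl
  intro j _
  have e : k + 1 - (j+1) = k - j := by omega
  rw [e]
  have := ww_succ_left B j
  push_cast
  rw [show α + 1 + 1 + (j:ℝ) = α + 1 + (j+1) by ring, pow_succ]
  linear_combination (-1) * ((-1)^j * ww (α+1+(j+1)) (k-j) * s^j) * this

theorem QQ_reflect (k : ℕ) (α B s : ℝ) :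
    QQ k α B s = (-1)^k * QQ k (B - α - k - 1) B (1 - s) := by
  induction k generalizing α B s with
  | zero => simp [QQ, ww_zero]
  | succ k ih =>
    refine eq_of_deriv (f := QQ (k+1) α B)
      (g := fun s => (-1)^(k+1) * QQ (k+1) (B-α-(k+1:ℕ)-1) B (1-s))
      (h := fun s => -B * QQ k (α+1) (B+1) s) (fun u => QQ_deriv k α B u) (fun u => ?_) 1 ?_ s
    · have h1 := QQ_deriv k (B-α-(k+1:ℕ)-1) B (1-u)
      have h2 : HasDerivAt (fun s : ℝ => 1 - s) (-1) u := by
        simpa using (hasDerivAt_id u).const_sub 1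
      have h3 := (h1.comp u h2).const_mul ((-1)^(k+1))
      refine HasDerivAt.congr_deriv h3 ?_
      rw [ih (α+1)]
      rw [show B + 1 - (α+1) - k - 1 = B - α - (k+1:ℕ) - 1 + 1 by push_cast; ring]
      ring
    · rw [QQ_one]
      simp only [sub_self]
      congr 1
      unfold QQ
      rw [Finset.sum_eq_single 0]
      · simp [ww_zero]
      · intro b _ hb; simp [hb]
      · simp

theorem jacobi_neg_one (k : ℕ) (a b : ℝ) (ha : -1 < a) :
    jacobiP k a b (1 - 2*1) = (-1)^k * ww (b+1) k := by
  rw [jacobi_eq_QQ k a b 1 ha, QQ_one]; congr 2; ring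

theorem jacobi_one (k : ℕ) (a b : ℝ) : jacobiP k a b 1 = ww (a+1) k := by
  unfold jacobiP
  rw [Finset.sum_eq_single 0]
  · simp [poch_zero, ww]
  · intro b _ hb; simp [hb]
  · simp

theorem poch_neg_shift (K j : ℕ) :
    ((K:ℝ)+1) * poch (-(K:ℝ)) j = ((K:ℝ)+1-j) * poch (-((K+1:ℕ):ℝ)) j := by
  have h1 := poch_succ_left (-((K+1:ℕ):ℝ)) j
  have h2 := poch_succ (-((K+1:ℕ):ℝ)) j
  rw [h2] at h1
  push_cast at *
  rw [show -((K:ℝ)+1)+1 = -K by ring] at h1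
  linarith

theorem jacobi_CD (α γ s : ℝ) (ha : 0 ≤ α) (hγ : -1 < γ) (K : ℕ) :
    ∑ k ∈ Finset.range (K+1), jacobiP k α γ (1-2*1) * jacobiP k α γ (1 - 2*s) / hJ k α γ
     = (-1)^K * (poch (α+γ+2) K / poch (α+1) K) * jacobiP K α (γ+1) (1-2*s) := by
  have hs : 0 < α + γ + 1 := by linarith
  induction K with
  | zero => 
    simp [jacobiP, hJ, poch_zero, hs.ne']
  | succ K ih =>
    rw [Finset.sum_range_succ, ih, jacobi_neg_one _ _ _ (by linarith)]
    unfold jacobiP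
    have hext : ∀ B : ℝ, ∑ j ∈ Finset.range (K+1),
        (poch (-(K:ℝ)) j * poch B j) / (poch (α + 1) j * (j.factorial : ℝ)) * ((1 - (1-2*s)) / 2) ^ j
        = ∑ j ∈ Finset.range (K+1+1),
        (poch (-(K:ℝ)) j * poch B j) / (poch (α + 1) j * (j.factorial : ℝ)) * ((1 - (1-2*s)) / 2) ^ j := by
      intro B
      rw [Finset.sum_range_succ _ (K+1), poch_succ (-(K:ℝ)) K]; simp
    rw [hext]
    simp only [Finset.mul_sum, Finset.sum_div]
    rw [← Finset.sum_add_distrib]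
    apply Finset.sum_congr rfl
    intro j _
    unfold hJ ww
    have q1 := poch_neg_shift K j
    have p1 := (poch_pos (show 0 < α+1 by linarith) j).ne'
    have p2 := (poch_pos (show 0 < α+1 by linarith) K).ne'
    have p3 := (poch_pos (show 0 < γ+1 by linarith) K).ne'
    have p4 := (poch_pos (show 0 < α+γ+2 by linarith) K).ne'
    have p5 : (α + 1 + K) ≠ 0 := by positivity
    have p6 : (γ + 1 + K) ≠ 0 := by have : (0:ℝ) ≤ K := by positivity
                                    linarith
    have p7 : (α + γ + 2 + K) ≠ 0 := by have : (0:ℝ) ≤ K := by positivity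
                                        linarith
    have p8 : (α + γ + 2*(K+1) + 1) ≠ 0 := by have : (0:ℝ) ≤ K := by positivity
                                              linarith
    have f1 := Nat.factorial_ne_zero K
    have f2 := Nat.factorial_ne_zero j
    have r1 := poch_succ_left (α+γ+2+K) j
    have r2 := poch_succ (α+γ+2+K) j
    rw [r2] at r1
    rw [poch_succ (α+1) K, poch_succ (γ+1) K, poch_succ (α+γ+2) K, Nat.factorial_succ]
    push_cast at *
    rw [show (K:ℝ) + α + (γ+1) + 1 = α+γ+2+K by ring, show (K:ℝ)+1+α+γ+1 = α+γ+2+K by ring,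
      show (K:ℝ)+1+α+(γ+1)+1 = α+γ+2+K+1 by ring]
    have p9 : α + γ + (K+1) + 1 ≠ 0 := by rw [show α + γ + (K+1) + 1 = α+γ+2+K by ring]; exact p7
    have p10 : (K:ℝ)+1 ≠ 0 := by positivity
    have X1 : poch (α+γ+2+K+1) j = poch (α+γ+2+K) j * (α+γ+2+K+j) / (α+γ+2+K) := by
      field_simp; linarith
    have X2 : poch (-(K:ℝ)) j = ((K:ℝ)+1-j) * poch (-((K:ℝ)+1)) j / (K+1) := by
      field_simp; linarith
    have hneg : ((-1:ℝ)^(K+1)) = -(-1)^K := by ring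
    rw [X1, X2, hneg]
    have hsq : ((-1:ℝ)^K)^2 = 1 := by rw [← pow_mul, mul_comm, pow_mul]; simp
    generalize poch (-((K:ℝ)+1)) j = Z1 at *
    generalize poch (α+γ+2+K) j = Z2 at *
    field_simp
    ring

/-- Gegenbauer polynomial -/
noncomputable def CC (ν : ℝ) (m : ℕ) (t : ℝ) : ℝ :=
  ∑ j ∈ Finset.range (m+1), (-4)^j * ww ν j * ww (2*ν+2*j) (m-j) * ((1-t)/2)^j

noncomputable def wi (a : ℝ) (m j : ℕ) : ℝ := if j ≤ m then ww a (m-j) else 0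

theorem CC_ext (ν : ℝ) (m : ℕ) (t : ℝ) (N : ℕ) (h : m + 1 ≤ N) : CC ν m t =
    ∑ j ∈ Finset.range N, (-4)^j * ww ν j * wi (2*ν+2*j) m j * ((1-t)/2)^j := by
  rw [← Finset.sum_subset (Finset.range_subset_range.2 h)]
  · apply Finset.sum_congr rfl
    intro j hj
    have hj : j ≤ m := by simpa [Nat.lt_succ_iff] using hj
    simp [wi, hj]
  · intro j _ hj
    have hj : ¬ j ≤ m := by simpa [Nat.lt_succ_iff] using hj
    simp [wi, hj]

theorem CC_rec (ν : ℝ) (m : ℕ) (t : ℝ) :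
    ((m:ℝ)+2) * CC ν (m+2) t = 2*(m+1+ν)*t*CC ν (m+1) t - (m+2*ν)*CC ν m t := by
  have key : 2*(m+1+ν)*t*CC ν (m+1) t = 2*(m+1+ν)*CC ν (m+1) t
     - 4*(m+1+ν)* (((1-t)/2) * CC ν (m+1) t) := by ring
  rw [key]
  rw [show ((1-t)/2) * CC ν (m+1) t = ∑ j ∈ Finset.range (m+2), (-4)^j * ww ν j *
     wi (2*ν+2*j) (m+1) j * ((1-t)/2)^(j+1) by
      rw [CC_ext ν (m+1) t (m+2) le_rfl, Finset.mul_sum]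
      apply Finset.sum_congr rfl; intros; ring]
  rw [CC_ext ν (m+2) t (m+3) le_rfl, CC_ext ν (m+1) t (m+3) (by omega),
    CC_ext ν m t (m+3) (by omega)]
  simp only [Finset.sum_range_succ' _ (m+2)]
  rw [mul_add, mul_add, mul_add]
  simp only [Finset.mul_sum]
  have h0 : ((m:ℝ)+2) * wi (2*ν+2*(0:ℕ)) (m+2) 0 = 2*(m+1+ν)*wi (2*ν+2*(0:ℕ)) (m+1) 0
      - (m+2*ν)*wi (2*ν+2*(0:ℕ)) m 0 := by
    simp only [wi, zero_le, if_true, Nat.sub_zero, Nat.cast_zero, mul_zero, add_zero]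
    have h1 := ww_succ (2*ν) (m+1)
    have h2 := ww_succ (2*ν) m
    push_cast at *
    linear_combination h1 - h2
  have hj : ∀ j ∈ Finset.range (m+2), ((m:ℝ)+2) * ((-4)^(j+1) * ww ν (j+1) *
      wi (2*ν+2*(j+1:ℕ)) (m+2) (j+1) * ((1-t)/2)^(j+1)) =
      2*(m+1+ν)*((-4)^(j+1) * ww ν (j+1) * wi (2*ν+2*(j+1:ℕ)) (m+1) (j+1) * ((1-t)/2)^(j+1))
      - 4*(m+1+ν)*((-4)^j * ww ν j * wi (2*ν+2*j) (m+1) j * ((1-t)/2)^(j+1))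
      - (m+2*ν)*((-4)^(j+1) * ww ν (j+1) * wi (2*ν+2*(j+1:ℕ)) m (j+1) * ((1-t)/2)^(j+1)) := by
    intro j hj
    have hj : j < m + 2 := by simpa using hj
    have g1 := ww_succ ν j
    rcases lt_trichotomy j m with h | h | h
    · obtain ⟨k, rfl⟩ := Nat.exists_eq_add_of_lt h
      simp only [wi, if_pos (show j+1 ≤ j+k+1+2 by omega), if_pos (show j+1 ≤ j+k+1+1 by omega),
        if_pos (show j+1 ≤ j+k+1 by omega), if_pos (show j ≤ j+k+1+1 by omega),
        show j+k+1+2-(j+1) = k+1+1 by omega, show j+k+1+1-(j+1) = k+1 by omega,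
        show j+k+1-(j+1)=k by omega, show j+k+1+1-j = k+1+1 by omega]
      push_cast
      rw [show 2*ν+2*((j:ℝ)+1) = 2*ν+2*j+1+1 by ring]
      set b := 2*ν+2*(j:ℝ) with hb
      have e1 := ww_succ (b+1+1) (k+1)
      have e2 := ww_succ (b+1+1) k
      have e3 := ww_succ_left b (k+1)
      have e4 := ww_succ_left (b+1) k
      push_cast at *
      have hk1 : (k:ℝ)+1 ≠ 0 := by positivity
      have hk2 : (k:ℝ)+1+1 ≠ 0 := by positivity
      have E2 : ww (b+1+1) (k+1) = (b+1+1+k) * ww (b+1+1) k / (k+1) := by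
        field_simp; linarith
      have E1 : ww (b+1+1) (k+1+1) = (b+1+1+(k+1))*((b+1+1+k) * ww (b+1+1) k / (k+1)) / (k+1+1) := by
        rw [← E2]; field_simp; linarith
      have E3 : ww ν j * ww b (k+1+1) = 2*(j+1)*ww ν (j+1) * ((b+1) * ww (b+1+1) k/(k+1))/(k+1+1) := by
        have E4 : ww (b+1) (k+1) = (b+1) * ww (b+1+1) k/(k+1) := by field_simp; linarith
        rw [← E4]; field_simp
        linear_combination (ww ν j) * e3 - 2 * ww (b+1) (k+1) * g1 + ww ν j * ww (b+1) (k+1) * hb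
      rw [E1, E2]
      rw [show ((-4:ℝ)) ^ j * ww ν j * ww b (k + 1 + 1) = (-4)^j * (ww ν j * ww b (k+1+1)) by ring, E3]
      have hν : ν = b/2 - j := by rw [hb]; ring
      rw [hν]
      field_simp
      ring
    · subst h
      simp only [wi, if_pos (show j+1 ≤ j+2 by omega), if_pos (show j+1 ≤ j+1 by omega),
        if_neg (show ¬ j+1 ≤ j by omega), if_pos (show j ≤ j+1 by omega),
        show j+2-(j+1) = 0+1 by omega, show j+1-(j+1) = 0 by omega, show j+1-j = 0+1 by omega, ww_zero]
      have e1 := ww_succ (2*ν+2*(j+1:ℕ)) 0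
      have e2 := ww_succ (2*ν+2*(j:ℕ)) 0
      simp only [ww_zero, Nat.cast_zero, zero_add, one_mul, add_zero, mul_one] at e1 e2
      rw [zero_add, e1, e2, pow_succ]
      push_cast
      linear_combination (8*(j+1+ν) *(-4)^j * ((1-t)/2)^(j+1)) * (-g1)
    · have : j = m+1 := by omega
      subst this
      simp only [wi, if_pos (show m+1+1 ≤ m+2 by omega), if_neg (show ¬ m+1+1 ≤ m+1 by omega),
        if_neg (show ¬ m+1+1 ≤ m by omega), if_pos (show m+1 ≤ m+1 by omega),
        show m+2-(m+1+1) = 0 by omega, show m+1-(m+1) = 0 by omega, ww_zero]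
      push_cast at *
      rw [pow_succ]
      linear_combination ((-4) *(-4)^(m+1) * ((1-t)/2)^(m+1+1)) * (g1)
  rw [Finset.sum_congr rfl hj]
  simp only [Finset.sum_sub_distrib, ← Finset.mul_sum]
  simp only [ww_zero, pow_zero, mul_one, one_mul] at *
  linear_combination h0

theorem CC_zero (ν t : ℝ) : CC ν 0 t = 1 := by simp [CC, ww_zero]
theorem CC_one (ν t : ℝ) : CC ν 1 t = 2*ν*t := by
  have h1 := ww_succ ν 0
  have h2 := ww_succ (2*ν) 0
  simp [ww_zero] at h1 h2
  simp [CC, Finset.sum_range_succ, ww_zero, h1, h2]; ring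

theorem CC_deriv (ν : ℝ) (m : ℕ) (t : ℝ) :
    HasDerivAt (CC ν (m+1)) (2*ν*CC (ν+1) m t) t := by
  unfold CC
  have h2 : HasDerivAt (fun s : ℝ => (1 - s)/2) (-1/2) t := by
    simpa using ((hasDerivAt_id t).const_sub 1).div_const 2
  have : ∀ j ∈ Finset.range (m+1+1), HasDerivAt
     (fun t : ℝ => (-4)^j * ww ν j * ww (2*ν+2*j) (m+1-j) * ((1-t)/2)^j)
     ((-4)^j * ww ν j * ww (2*ν+2*j) (m+1-j) * (j * ((1-t)/2)^(j-1) * (-1/2))) t := fun j _ =>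
    (h2.fun_pow j).const_mul _
  have := HasDerivAt.fun_sum this
  refine this.congr_deriv ?_
  rw [Finset.sum_range_succ', Finset.mul_sum]
  simp only [Nat.cast_zero, zero_mul, mul_zero, add_zero]
  apply Finset.sum_congr rfl
  intro j _
  have e : m + 1 - (j+1) = m - j := by omega
  rw [e]
  have := ww_succ_left ν j
  push_cast
  rw [show 2*(ν+1)+2*(j:ℝ) = 2*ν+2*(j+1) by ring, pow_succ]
  linear_combination (2*(-4)^j * ww (2*ν+2*(j+1)) (m-j) * ((1-t)/2)^j) * this

theorem CC_one_eq_U (m : ℕ) (t : ℝ) :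
    CC 1 m t = (Polynomial.Chebyshev.U ℝ (m:ℤ)).eval t := by
  induction m using Nat.twoStepInduction with
  | zero => simp [CC_zero]
  | one => simp [CC_one]
  | more m h1 h2 =>
    have h := CC_rec 1 m t
    have hm : (m:ℝ)+2 ≠ 0 := by positivity
    push_cast at *
    rw [Polynomial.Chebyshev.U_add_two]
    simp only [Polynomial.eval_sub, Polynomial.eval_mul, Polynomial.eval_X, Polynomial.eval_ofNat]
    rw [← h1, ← h2]
    apply mul_left_cancel₀ hm
    rw [h]; ring

noncomputable def ZZ (lam : ℝ) (m : ℕ) (t : ℝ) : ℝ :=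
  CC (lam+1) m t - if 2 ≤ m then CC (lam+1) (m-2) t else 0

theorem poch_double (a : ℝ) (j : ℕ) : poch (2*a) (2*j) = 4^j * poch a j * poch (a+1/2) j := by
  induction j with
  | zero => simp [poch_zero]
  | succ j ih =>
    rw [show 2*(j+1) = 2*j+1+1 by ring, poch_succ, poch_succ, poch_succ a, poch_succ (a+1/2), ih]
    push_cast; ring

theorem gegen_CC (lam : ℝ) (hl : 0 < lam) (m : ℕ) (t : ℝ) :
   (poch (2 * lam) m / poch (lam + 1/2) m) * jacobiP m (lam - 1/2) (lam - 1/2) t = CC lam m t := by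
  unfold jacobiP CC
  rw [Finset.mul_sum, Finset.mul_sum]
  apply Finset.sum_congr rfl
  intro j hj
  have hj : j ≤ m := by simpa [Nat.lt_succ_iff] using hj
  rw [poch_neg_nat m j hj]
  obtain ⟨r, rfl⟩ := Nat.exists_eq_add_of_le hj
  have h1 := (poch_pos (show 0 < lam + 1/2 by linarith) j).ne'
  have h2 := (poch_pos (show 0 < lam + 1/2 by linarith) (j+r)).ne'
  have e2 : j + r - j = r := by omega
  rw [e2]; unfold ww
  rw [show lam - 1/2+1 = lam + 1/2 by ring,
    show ((j+r:ℕ):ℝ) + (lam-1/2)+(lam-1/2)+1 = 2*lam+(j+r:ℕ) by ring]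
  have k1 := poch_add (2*lam) (j+r) j
  rw [show j+r+j = 2*j+r by ring, poch_add, poch_double] at k1
  have := Nat.factorial_ne_zero r
  have := Nat.factorial_ne_zero (j+r)
  have := Nat.factorial_ne_zero j
  rw [show (-4:ℝ)^j = (-1)^j * 4^j by rw [← mul_pow]; norm_num]
  push_cast at *
  generalize ((1-t)/2)^j = x
  generalize (4:ℝ)^j = y at *
  generalize (-1:ℝ)^j = z at *
  generalize poch (lam+1/2) j = p1 at *
  generalize poch (lam+1/2) (j+r) = p2 at *
  generalize poch lam j = p3 at *
  generalize poch (2*lam) (j+r) = p4 at *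
  generalize poch (2*lam+(j+r)) j = p5 at *
  generalize poch (2*lam+2*j) r = p6 at *
  field_simp
  linear_combination (-(x*z)) * k1

theorem CC_ZZ (lam : ℝ) (hl : 0 < lam) (m : ℕ) (t : ℝ) :
   ((m:ℝ)+lam)/lam * CC lam m t = ZZ lam m t := by
  rcases m with _ | _ | m
  · simp [ZZ, CC_zero, hl.ne']
  · simp [ZZ, CC_one]; field_simp; ring
  · simp only [ZZ, if_pos (show 2 ≤ m+1+1 by omega), show m+1+1-2 = m by omega]
    rw [CC_ext _ (m+1+1) t (m+3) le_rfl, CC_ext _ (m+1+1) t (m+3) le_rfl,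
      CC_ext _ m t (m+3) (by omega), Finset.mul_sum, ← Finset.sum_sub_distrib]
    apply Finset.sum_congr rfl
    intro j hj
    have hj : j < m+3 := by simpa using hj
    have s1 := ww_shift lam j
    have s1' : ww (lam+1) j = (lam+j) * ww lam j / lam := by field_simp; linarith
    have hlj : lam + j ≠ 0 := by positivity
    rw [s1', show 2*(lam+1)+2*(j:ℝ) = 2*lam+2*j+1+1 by ring]
    set b := 2*lam+2*(j:ℝ) with hb
    suffices (m+2+lam) * wi b (m+1+1) j = (lam+j) * (wi (b+1+1) (m+1+1) j - wi (b+1+1) m j) by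
      push_cast
      generalize ((1-t)/2)^j = x
      generalize (-4:ℝ)^j = y
      field_simp
      linear_combination (y * ww lam j * x) * this
    rcases lt_trichotomy j (m+1) with h | h | h
    · obtain ⟨k, rfl⟩ := Nat.exists_eq_add_of_le (Nat.lt_succ_iff.1 h)
      simp only [wi, if_pos (show j ≤ j+k+1+1 by omega), if_pos (show j ≤ j+k by omega),
        show j+k+1+1-j = k+1+1 by omega, show j+k-j=k by omega]
      have e1 := ww_pascal (b+1) (k+1)
      have e2 := ww_pascal (b+1) k
      have e3 := ww_succ_left b (k+1)
      have e4 := ww_succ (b+1) (k+1)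
      have hl' : lam = b/2 - j := by rw [hb]; ring
      have hk : (k:ℝ)+2 ≠ 0 := by positivity
      push_cast at *
      rw [e1, e2, hl']
      have E3 : ww b (k+1+1) = b * ww (b+1) (k+1) / (k+2) := by field_simp; linarith
      have E4 : ww (b+1) (k+1+1) = (b+1+(k+1)) * ww (b+1) (k+1) / (k+2) := by field_simp; linarith
      rw [E3, E4]
      field_simp
      ring
    · subst h
      simp only [wi, if_pos (show m+1 ≤ m+1+1 by omega), if_neg (show ¬ m+1 ≤ m by omega),
        show m+1+1-(m+1) = 0+1 by omega]
      have e1 := ww_succ b 0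
      have e2 := ww_succ (b+1+1) 0
      simp only [ww_zero, Nat.cast_zero, zero_add, one_mul, add_zero, mul_one] at e1 e2
      rw [zero_add, e1, e2, hb]; push_cast; ring
    · have : j = m+2 := by omega
      subst this
      simp [wi, ww_zero]; ring

theorem Zm_eq (lam : ℝ) (hl : 0 ≤ lam) (m : ℕ) (t : ℝ) : Zm lam m t = ZZ lam m t := by
  unfold Zm
  split_ifs with h h2
  · subst h h2; simp [ZZ, CC_zero]
  · subst h
    rcases m with _ | _ | m
    · simp at h2
    · simp [ZZ, CC_one]
    · simp only [ZZ, if_pos (show 2 ≤ m+1+1 by omega), show m+1+1-2 = m by omega, zero_add,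
        CC_one_eq_U]
      have := congrArg (Polynomial.eval t) (Polynomial.Chebyshev.two_mul_T_eq_U_sub_U (R := ℝ) m)
      simp only [Polynomial.eval_sub, Polynomial.eval_mul, Polynomial.eval_ofNat] at this
      push_cast
      rw [show (m:ℤ)+1+1 = m+2 by ring]
      exact this
  · have hl' : 0 < lam := lt_of_le_of_ne hl (Ne.symm h)
    rw [mul_assoc, gegen_CC lam hl', CC_ZZ lam hl']

theorem ZZ_zero (lam t : ℝ) : ZZ lam 0 t = 1 := by simp [ZZ, CC_zero]

theorem ZZ_deriv (lam : ℝ) (m : ℕ) (t : ℝ) :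
    HasDerivAt (ZZ lam (m+1)) (2*(lam+1)*ZZ (lam+1) m t) t := by
  rcases m with _ | _ | m
  · have := CC_deriv (lam+1) 0 t
    unfold ZZ
    simpa using this
  · have := CC_deriv (lam+1) 1 t
    have h2 := (hasDerivAt_const t (CC (lam+1) 0 t))
    have : HasDerivAt (fun t => CC (lam+1) 2 t - 1) (2*(lam+1)*CC (lam+1+1) 1 t) t := this.sub_const 1
    unfold ZZ
    simpa [CC_zero] using this
  · have h1 := CC_deriv (lam+1) (m+2) t
    have h2 := CC_deriv (lam+1) m t
    have := h1.fun_sub h2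
    unfold ZZ
    simp only [if_pos (show 2 ≤ m+1+1+1 by omega), if_pos (show 2 ≤ m+1+1 by omega),
      show m+1+1+1-2 = m+1 by omega, show m+1+1-2 = m by omega]
    refine this.congr_deriv ?_
    ring

noncomputable def LL (n : ℕ) (lam γ s u : ℝ) : ℝ :=
  ∑ m ∈ Finset.range (n+1), (-1)^(n-m) * jacobiP (n-m) (m+lam) (γ+1) (1-2*s) *
    (√s^m * ZZ lam m (u/√s))

theorem LL_zero (lam γ s u : ℝ) : LL 0 lam γ s u = 1 := by
  simp [LL, ZZ_zero, jacobiP, poch_zero]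

theorem LL_deriv (n : ℕ) (lam γ s u : ℝ) (hs : 0 < s) :
    HasDerivAt (LL (n+1) lam γ s) (2*(lam+1)*LL n (lam+1) γ s u) u := by
  have hq : 0 < √s := Real.sqrt_pos.2 hs
  unfold LL
  simp only [Finset.sum_range_succ' _ (n+1), ZZ_zero]
  apply HasDerivAt.add_const
  rw [Finset.mul_sum]
  apply HasDerivAt.fun_sum
  intro m _
  have h2 : HasDerivAt (fun u : ℝ => u/√s) (1/√s) u := (hasDerivAt_id u).div_const _
  have h3 := (ZZ_deriv lam m (u/√s)).comp u h2
  have h4 := (h3.const_mul (√s^(m+1))).const_mul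
    ((-1)^(n+1-(m+1)) * jacobiP (n+1-(m+1)) ((m+1:ℕ)+lam) (γ+1) (1-2*s))
  refine h4.congr_deriv ?_
  rw [show n+1-(m+1) = n-m by omega]
  push_cast
  rw [show (m:ℝ)+1+lam = m+(lam+1) by ring, pow_succ]
  field_simp

/-- three-term recurrence of the product series -/
noncomputable def Psi (ν s : ℝ) (m : ℕ) : ℝ := PowerSeries.coeff m (pw ν * pws s ν)

theorem pw_deriv_eq (ν : ℝ) : (1 - PowerSeries.X) * PowerSeries.derivative ℝ (pw ν) = PowerSeries.C ν * pw ν := by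
  ext k
  rw [sub_mul, one_mul, map_sub, PowerSeries.coeff_C_mul, PowerSeries.coeff_derivative, coeff_pw, coeff_pw]
  rcases k with _ | k
  · have := ww_succ ν 0
    simp at *
    linarith
  · rw [PowerSeries.coeff_succ_X_mul, PowerSeries.coeff_derivative, coeff_pw]
    have := ww_succ ν (k+1)
    push_cast at *
    linear_combination this

theorem pws_deriv_eq (ν s : ℝ) : (1 - PowerSeries.C s * PowerSeries.X) * PowerSeries.derivative ℝ (pws s ν) = PowerSeries.C (s*ν) * pws s ν := by
  ext k
  rw [sub_mul, one_mul, map_sub, PowerSeries.coeff_C_mul, PowerSeries.coeff_derivative, coeff_pws, coeff_pws, mul_assoc (PowerSeries.C s), PowerSeries.coeff_C_mul]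
  rcases k with _ | k
  · have := ww_succ ν 0
    simp at *
    linear_combination s*this
  · rw [PowerSeries.coeff_succ_X_mul, PowerSeries.coeff_derivative, coeff_pws]
    have := ww_succ ν (k+1)
    push_cast at *
    linear_combination s^(k+1+1)*this

theorem Psi_rec (ν s : ℝ) (m : ℕ) :
    ((m:ℝ)+2)*Psi ν s (m+2) = (1+s)*(m+1+ν)*Psi ν s (m+1) - s*(m+2*ν)*Psi ν s m := by
  have h1 := pw_deriv_eq ν
  have h2 := pws_deriv_eq ν s
  have h3 := (PowerSeries.derivative ℝ).leibniz (pw ν) (pws s ν)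
  simp only [smul_eq_mul] at h3
  have h4 : (1 - PowerSeries.X) * (1 - PowerSeries.C s * PowerSeries.X) * PowerSeries.derivative ℝ (pw ν * pws s ν) = (PowerSeries.C (ν*(1+s)) - PowerSeries.C (2*s*ν) * PowerSeries.X) * (pw ν * pws s ν) := by
    rw [h3]
    have c1 : (PowerSeries.C (s*ν) : PowerSeries ℝ) = PowerSeries.C s * PowerSeries.C ν := map_mul _ _ _
    have c2 : (PowerSeries.C (ν*(1+s)) : PowerSeries ℝ) = PowerSeries.C ν * (1+PowerSeries.C s) := by simp
    have c3 : (PowerSeries.C (2*s*ν) : PowerSeries ℝ) = 2*PowerSeries.C s * PowerSeries.C ν := by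
      rw [show 2*s*ν = s*ν+s*ν by ring, map_add, map_mul]; ring
    rw [c1] at h2
    rw [c2, c3]
    linear_combination (1 - PowerSeries.C s * PowerSeries.X) * pws s ν * h1 + (1 - PowerSeries.X) * pw ν * h2
  have h5 := congrArg (PowerSeries.coeff (m+1)) h4
  obtain ⟨c0, hc0⟩ : ∃ c0, c0 = 1+s := ⟨_, rfl⟩
  have e : (1 - PowerSeries.X) * (1 - PowerSeries.C s * PowerSeries.X) * PowerSeries.derivative ℝ (pw ν * pws s ν) = PowerSeries.derivative ℝ (pw ν * pws s ν) - PowerSeries.C c0 * (PowerSeries.X * PowerSeries.derivative ℝ (pw ν * pws s ν)) + PowerSeries.C s * (PowerSeries.X * (PowerSeries.X * PowerSeries.derivative ℝ (pw ν * pws s ν))) := by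
    have c2 : (PowerSeries.C c0 : PowerSeries ℝ) = 1+PowerSeries.C s := by rw [hc0]; simp
    rw [c2]; ring
  rw [e, sub_mul, mul_assoc (PowerSeries.C (2*s*ν))] at h5
  simp only [map_add, map_sub, PowerSeries.coeff_C_mul, PowerSeries.coeff_succ_X_mul, PowerSeries.coeff_derivative] at h5
  have e3 : (PowerSeries.coeff m) (PowerSeries.X * PowerSeries.derivative ℝ (pw ν * pws s ν)) = m * Psi ν s m := by
    rcases m with _ | m
    · simp
    · rw [PowerSeries.coeff_succ_X_mul, PowerSeries.coeff_derivative]; unfold Psi; push_cast; ring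
  rw [e3] at h5
  rw [hc0] at h5
  unfold Psi at *
  push_cast at *
  linear_combination h5

theorem CC_line (ν s : ℝ) (hs : 0 < s) (m : ℕ) :
    √s^m * CC ν m ((1+s)/2/√s) = Psi ν s m := by
  have hq : 0 < √s := Real.sqrt_pos.2 hs
  have hq2 : √s^2 = s := Real.sq_sqrt hs.le
  have w1 : ww ν 1 = ν := by
    have := ww_succ ν 0
    simpa [ww_zero] using this
  induction m using Nat.twoStepInduction with
  | zero => simp [CC_zero, Psi, PowerSeries.coeff_mul, coeff_pw, coeff_pws, ww_zero]
  | one =>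
    have : Finset.HasAntidiagonal.antidiagonal 1 = ({(0,1),(1,0)} : Finset (ℕ×ℕ)) := rfl
    simp [CC_one, Psi, PowerSeries.coeff_mul, coeff_pw, coeff_pws, ww_zero, this, w1]
    field_simp
    ring
  | more m h1 h2 =>
    have h := CC_rec ν m ((1+s)/2/√s)
    have h3 := Psi_rec ν s m
    rw [← h1, ← h2] at h3
    have hm : (m:ℝ)+2 ≠ 0 := by positivity
    apply mul_left_cancel₀ hm
    rw [h3]
    have e : ((1+s)/2/√s)*√s = (1+s)/2 := by field_simp
    generalize ((1+s)/2/√s) = t at *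
    linear_combination √s^(m+2)*h + 2*(m+1+ν)*√s^(m+1)*CC ν (m+1) t*e  - (m+2*ν)*√s^m*CC ν m t*hq2

theorem ZZ_line (lam s : ℝ) (hs : 0 < s) (m : ℕ) :
    √s^m * ZZ lam m ((1+s)/2/√s) = PowerSeries.coeff m
      ((1 - PowerSeries.C s * PowerSeries.X^2) * (pw (lam+1) * pws s (lam+1))) := by
  have hq2 : √s^2 = s := Real.sq_sqrt hs.le
  have h1 := CC_line (lam+1) s hs m
  unfold ZZ
  rw [sub_mul, one_mul, map_sub, mul_sub, h1, mul_assoc, PowerSeries.coeff_C_mul,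
    PowerSeries.coeff_X_pow_mul']
  unfold Psi
  congr 1
  split_ifs with h
  · obtain ⟨k, rfl⟩ := Nat.exists_eq_add_of_le h
    have h2 := CC_line (lam+1) s hs k
    rw [show 2+k-2 = k by omega, pow_add, hq2, mul_assoc, h2]
    rfl
  · simp

theorem ww_line (n : ℕ) (A : ℝ) (k j : ℕ) (h : k + j = n) (hk : 1 ≤ k) (hj : 1 ≤ j) :
    ((n:ℝ)+A) * (ww (n+A+1) j * ww (1-n) k - ww (n+A+1) (j-1) * ww (1-n) (k-1))
     = (2*n+A) * (ww (n+A) j * ww (1-n) k) := by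
  obtain ⟨j, rfl⟩ := Nat.exists_eq_add_of_le hj
  obtain ⟨k, rfl⟩ := Nat.exists_eq_add_of_le hk
  rw [show 1+j-1 = j by omega, show 1+k-1 = k by omega, add_comm 1 j, add_comm 1 k] at *
  subst h
  have h1 := ww_shift (((k+1+(j+1):ℕ):ℝ)+A) (j+1)
  have h2 := ww_succ_left (((k+1+(j+1):ℕ):ℝ)+A) j
  have h3 := ww_succ (1-((k+1+(j+1):ℕ):ℝ)) k
  generalize ww (((k+1+(j+1):ℕ):ℝ)+A+1) (j+1) = x1 at *
  generalize ww (((k+1+(j+1):ℕ):ℝ)+A+1) j = x2 at *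
  generalize ww (((k+1+(j+1):ℕ):ℝ)+A) (j+1) = x3 at *
  generalize ww (1-((k+1+(j+1):ℕ):ℝ)) (k+1) = x4 at *
  generalize ww (1-((k+1+(j+1):ℕ):ℝ)) k = x5 at *
  push_cast at *
  linear_combination x4 * h1 + x5 * h2 - x3 * h3

theorem LL_line (n : ℕ) (lam γ s : ℝ) (hl : 0 ≤ lam) (hγ : -1 < γ) (hs : 0 < s) :
    LL (n+1) lam γ s ((1+s)/2) =
      (2*(n+1:ℕ)+(γ+2*lam+2))/((n+1:ℕ)+(γ+2*lam+2)) *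
        QQ (n+1) (γ+2*lam+2) ((n+1:ℕ)+(γ+2*lam+2)) (1-s) := by
  obtain ⟨A, hA⟩ : ∃ A, A = γ+2*lam+2 := ⟨_, rfl⟩
  obtain ⟨N, hN⟩ : ∃ N, N = n+1 := ⟨_, rfl⟩
  have hA0 : 0 < A := by linarith
  rw [← hA, ← hN]
  have hNA : (N:ℝ)+A ≠ 0 := by positivity
  have h1 : LL N lam γ s ((1+s)/2) = PowerSeries.coeff N
      (((1 - PowerSeries.C s * PowerSeries.X^2) * (pw (lam+1) * pws s (lam+1))) *
       (pws s (N+lam+γ+2) * pw (-(N+lam)))) := by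
    rw [PowerSeries.coeff_mul, Finset.Nat.sum_antidiagonal_eq_sum_range_succ_mk, LL]
    apply Finset.sum_congr rfl
    intro m hm
    have hm : m ≤ N := by simpa [Nat.lt_succ_iff] using hm
    dsimp only
    rw [ZZ_line lam s hs, jacobi_eq_QQ _ _ _ _ (by have := Nat.cast_nonneg (α := ℝ) m; linarith), QQ_coeff, mul_comm,
      Nat.cast_sub hm]
    congr 4
    · ring_nf
    · ring_nf
  have h2 : (((1 - PowerSeries.C s * PowerSeries.X^2) * (pw (lam+1) * pws s (lam+1))) *
       (pws s (N+lam+γ+2) * pw (-(N+lam)))) = pws s (N+A+1) * pw (1-N) -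
         PowerSeries.C s * (PowerSeries.X^2 * (pws s (N+A+1) * pw (1-N))) := by
    have e1 : pws s (N+A+1) = pws s (lam+1) * pws s (N+lam+γ+2) := by
      rw [pws_mul, hA]; congr 1; ring
    have e2 : pw (1-(N:ℝ)) = pw (lam+1) * pw (-(N+lam)) := by
      rw [pw_mul]; congr 1; ring
    rw [e1, e2]; ring
  have h4 := QQ_coeff N (-1) (N+A) s
  rw [QQ_reflect, ← mul_assoc, ← mul_pow] at h4
  simp only [mul_neg, mul_one, neg_neg, one_pow, one_mul] at h4
  rw [show (N:ℝ)+A-(-1)-N-1 = A by ring, show -((N:ℝ)+-1) = 1-N by ring] at h4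
  rw [h1, h2, h4, map_sub, PowerSeries.coeff_C_mul, div_mul_eq_mul_div, eq_div_iff hNA]
  have z : ww (1-(N:ℝ)) (n+1) = 0 := by
    have := ww_succ (1-(N:ℝ)) n
    rw [hN] at *
    push_cast at *
    have hn : (n:ℝ)+1 ≠ 0 := by positivity
    apply mul_left_cancel₀ hn
    rw [this]; ring
  have h5 : PowerSeries.coeff N (PowerSeries.X^2 * (pws s (N+A+1) * pw (1-N))) =
     ∑ j ∈ Finset.range n, s^j * (ww (N+A+1) j * ww (1-N) (n-j-1)) := by
    rw [PowerSeries.coeff_X_pow_mul']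
    rcases n with _ | n
    · simp [hN]
    · rw [if_pos (by omega), show N - 2 = n by omega, PowerSeries.coeff_mul,
        Finset.Nat.sum_antidiagonal_eq_sum_range_succ_mk]
      apply Finset.sum_congr rfl
      intro j _
      simp only [coeff_pws, coeff_pw]
      rw [show n+1-j-1 = n-j by omega]; ring
  have h6 : ∀ B : ℝ, PowerSeries.coeff N (pws s B * pw (1-N)) =
     ∑ j ∈ Finset.range n, s^(j+1) * (ww B (j+1) * ww (1-N) (n-j)) + s^(n+1) * ww B (n+1) := by
    intro B
    rw [PowerSeries.coeff_mul, Finset.Nat.sum_antidiagonal_eq_sum_range_succ_mk]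
    simp only [coeff_pws, coeff_pw]
    rw [show N.succ = n+1+1 by omega, Finset.sum_range_succ', Finset.sum_range_succ]
    rw [show N - 0 = n+1 by omega, z, show N - (n+1) = 0 by omega, ww_zero, mul_zero, add_zero, mul_one]
    congr 1
    apply Finset.sum_congr rfl
    intro j _
    rw [show N-(j+1) = n-j by omega]; ring
  rw [h5, h6, h6]
  have sh := ww_shift (N+A) (n+1)
  have hNn : (N:ℝ) = n+1 := by rw [hN]; push_cast; ring
  have h7 : ∀ j ∈ Finset.range n, (2*N+A) * (s^(j+1) * (ww (N+A) (j+1) * ww (1-N) (n-j))) =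
     (N+A) * (s^(j+1) * (ww (N+A+1) (j+1) * ww (1-N) (n-j)))
      - (N+A) * (s * (s^j * (ww (N+A+1) j * ww (1-N) (n-j-1)))) := by
    intro j hj
    have hj : j < n := by simpa using hj
    have := ww_line N A (n-j) (j+1) (by omega) (by omega) (by omega)
    rw [show j+1-1 = j by omega] at this
    linear_combination (-s^(j+1)) * this
  have h8 := Finset.sum_congr rfl h7
  rw [Finset.sum_sub_distrib, ← Finset.mul_sum, ← Finset.mul_sum, ← Finset.mul_sum,
    ← Finset.mul_sum] at h8
  push_cast at sh
  linear_combination s^(n+1) * sh + s^(n+1) * ww (N+A) (n+1) * (-1) * hNn - h8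

noncomputable def KK (n j : ℕ) (A : ℝ) : ℝ :=
  (-1)^j * (2*n+A) * poch A (n+j) / (poch A (2*j+1) * ((n-j).factorial : ℝ))

noncomputable def RR (n : ℕ) (lam γ s u : ℝ) : ℝ :=
  ∑ j ∈ Finset.range (n+1), ∑ i ∈ Finset.range (j+1),
    KK n j (γ+2*lam+2) * ww (lam+γ+2+j) (j-i) * ww (lam+1) i * (1-s)^(j-i) * (2*(1-u))^i

theorem KK_shift (n j : ℕ) (A : ℝ) (hA : 0 < A) : KK (n+1) (j+1) A = - KK n j (A+2) := by
  unfold KK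
  have h1 : poch A (n+1+(j+1)) = A*((A+1)*poch (A+2) (n+j)) := by
    rw [show n+1+(j+1) = (n+j)+1+1 by ring, poch_succ_left, poch_succ_left]; ring_nf
  have h2 : poch A (2*(j+1)+1) = A*((A+1)*poch (A+2) (2*j+1)) := by
    rw [show 2*(j+1)+1 = (2*j+1)+1+1 by ring, poch_succ_left, poch_succ_left]; ring_nf
  have h3 := (poch_pos (show 0 < A+2 by linarith) (2*j+1)).ne'
  have := Nat.factorial_ne_zero (n-j)
  rw [h1, h2, show n+1-(j+1) = n-j by omega, pow_succ]
  push_cast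
  field_simp
  ring

theorem RR_deriv (n : ℕ) (lam γ s u : ℝ) (hA : 0 < γ+2*lam+2) :
    HasDerivAt (RR (n+1) lam γ s) (2*(lam+1)*RR n (lam+1) γ s u) u := by
  have h2 : HasDerivAt (fun u : ℝ => 2*(1 - u)) (-2) u := by
    simpa using ((hasDerivAt_id u).const_sub 1).const_mul 2
  have h3 : ∀ j ∈ Finset.range (n+1+1), HasDerivAt (fun u : ℝ => ∑ i ∈ Finset.range (j+1),
    KK (n+1) j (γ+2*lam+2) * ww (lam+γ+2+j) (j-i) * ww (lam+1) i * (1-s)^(j-i) * (2*(1-u))^i)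
    (∑ i ∈ Finset.range (j+1),
    KK (n+1) j (γ+2*lam+2) * ww (lam+γ+2+j) (j-i) * ww (lam+1) i * (1-s)^(j-i) * (i*(2*(1-u))^(i-1)*(-2))) u := by
    intro j _
    apply HasDerivAt.fun_sum
    intro i _
    exact (h2.fun_pow i).const_mul _
  have := HasDerivAt.fun_sum h3
  unfold RR
  refine this.congr_deriv ?_
  rw [Finset.sum_range_succ', Finset.mul_sum]
  simp only [zero_add, Finset.sum_range_one, Nat.cast_zero, zero_mul, mul_zero, add_zero]
  apply Finset.sum_congr rfl
  intro j _
  rw [Finset.sum_range_succ', Finset.mul_sum]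
  simp only [Nat.cast_zero, zero_mul, mul_zero, add_zero]
  apply Finset.sum_congr rfl
  intro i _
  have := ww_succ_left (lam+1) i
  rw [KK_shift _ _ _ hA, show j+1-(i+1) = j-i by omega, show i+1-1 = i by omega]
  push_cast
  rw [show lam+γ+2+((j:ℝ)+1) = lam+1+γ+2+j by ring, show γ+2*lam+2+2 = γ+2*(lam+1)+2 by ring]
  linear_combination (2*KK n j (γ+2*(lam+1)+2) * ww (lam+1+γ+2+j) (j-i) * (1-s)^(j-i) * (2*(1-u))^i) * this

theorem RR_line (n : ℕ) (lam γ s : ℝ) (hA : 0 < γ+2*lam+2) :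
    RR n lam γ s ((1+s)/2) =
      (2*n+(γ+2*lam+2))/(n+(γ+2*lam+2)) * QQ n (γ+2*lam+2) (n+(γ+2*lam+2)) (1-s) := by
  unfold RR QQ
  rw [Finset.mul_sum]
  apply Finset.sum_congr rfl
  intro j hj
  have hj : j ≤ n := by simpa [Nat.lt_succ_iff] using hj
  have h1 : ∑ i ∈ Finset.range (j+1), KK n j (γ+2*lam+2) * ww (lam+γ+2+j) (j-i) * ww (lam+1) i
      * (1-s)^(j-i) * (2*(1-(1+s)/2))^i =
      KK n j (γ+2*lam+2) * (1-s)^j * ww (γ+2*lam+2+1+j) j := by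
    have := vander (lam+1) (lam+γ+2+j) j
    rw [Finset.Nat.sum_antidiagonal_eq_sum_range_succ_mk] at this
    rw [show γ+2*lam+2+1+(j:ℝ) = lam+1+(lam+γ+2+j) by ring, ← this, Finset.mul_sum]
    apply Finset.sum_congr rfl
    intro i hi
    have hi : i ≤ j := by simpa [Nat.lt_succ_iff] using hi
    rw [show (1-s)^j = (1-s)^(j-i)*(1-s)^i by rw [← pow_add]; congr 1; omega,
      show 2*(1-(1+s)/2) = 1-s by ring]
    ring
  rw [h1]
  generalize γ+2*lam+2 = A at *
  unfold KK ww
  obtain ⟨r, rfl⟩ := Nat.exists_eq_add_of_le hj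
  rw [show j+r-j = r by omega]
  have e1 := poch_add A (j+1) j
  have e2 := poch_add A (j+1) r
  have e3 := poch_succ A (j+r)
  have e4 := poch_add A (j+r) j
  rw [show j+1+j = 2*j+1 by ring] at e1
  rw [show j+1+r = j+r+1 by ring, e3] at e2
  have hp1 := (poch_pos hA (j+1)).ne'
  have hp2 := (poch_pos (show 0 < A+1+j by positivity) j).ne'
  have hnA : ((j+r:ℕ):ℝ)+A ≠ 0 := by positivity
  rw [e4, e1, show A+((j+1:ℕ):ℝ) = A+1+j by push_cast; ring, add_comm ((j+r:ℕ):ℝ) A]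
  rw [show A+((j+1:ℕ):ℝ) = A+1+j by push_cast; ring] at e2
  rw [add_comm _ A] at hnA
  have := Nat.factorial_ne_zero r
  have := Nat.factorial_ne_zero j
  generalize poch A (j+1) = p1 at *
  generalize poch (A+1+j) j = p2 at *
  generalize poch (A+1+j) r = p3 at *
  generalize poch A (j+r) = p4 at *
  generalize poch (A+((j+r:ℕ):ℝ)) j = p5 at *
  generalize (1-s)^j = x at *
  generalize A+((j+r:ℕ):ℝ) = B at *
  field_simp
  linear_combination x*p5*e2

theorem RR_zero (lam γ s u : ℝ) (hA : 0 < γ+2*lam+2) : RR 0 lam γ s u = 1 := by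
  simp [RR, KK, poch_zero, ww_zero, poch_succ, hA.ne']

theorem LL_eq_RR (n : ℕ) (lam γ s u : ℝ) (hl : 0 ≤ lam) (hγ : -1 < γ) (hs : 0 < s) :
    LL n lam γ s u = RR n lam γ s u := by
  induction n generalizing lam u with
  | zero => rw [LL_zero, RR_zero _ _ _ _ (by linarith)]
  | succ n ih =>
    refine eq_of_deriv (h := fun u => 2*(lam+1)*LL n (lam+1) γ s u) (fun u => LL_deriv n lam γ s u hs)
      (fun u => ?_) ((1+s)/2) ?_ u
    · have := RR_deriv n lam γ s u (by linarith)
      rwa [← ih (lam+1) u (by linarith)] at this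
    · rw [LL_line n lam γ s hl hγ hs, RR_line _ _ _ _ (by linarith)]

noncomputable def MI (a b : ℝ) (i l : ℕ) (v : ℝ) : ℝ :=
  ((1+v)/2)^i * ((1-v)/2)^l * ((1-v)^a * (1+v)^b)

noncomputable def MM (a b : ℝ) (i l : ℕ) : ℝ := ∫ v in (-1:ℝ)..1, MI a b i l v

theorem MI_cont (a b : ℝ) (ha : 0 ≤ a) (hb : 0 ≤ b) (i l : ℕ) : Continuous (MI a b i l) := by
  unfold MI
  have h1 : Continuous fun v : ℝ => (1-v)^a :=
    Continuous.rpow_const (by fun_prop) (fun _ => Or.inr ha)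
  have h2 : Continuous fun v : ℝ => (1+v)^b :=
    Continuous.rpow_const (by fun_prop) (fun _ => Or.inr hb)
  fun_prop

theorem MM_add (a b : ℝ) (ha : 0 ≤ a) (hb : 0 ≤ b) (i l : ℕ) :
    MM a b (i+1) l + MM a b i (l+1) = MM a b i l := by
  unfold MM
  rw [← intervalIntegral.integral_add ((MI_cont a b ha hb _ _).intervalIntegrable _ _)
    ((MI_cont a b ha hb _ _).intervalIntegrable _ _)]
  congr 1; ext v; unfold MI; ring

theorem MM_parts (a b : ℝ) (ha : 0 ≤ a) (hb : 0 ≤ b) (i l : ℕ) :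
    (a+1+l) * MM a b (i+1) l = (b+1+i) * MM a b i (l+1) := by
  have key : ∫ v in (-1:ℝ)..1, (2*((b+1+i) * MI a b i (l+1) v - (a+1+l) * MI a b (i+1) l v)) = 0 := by
    rw [intervalIntegral.integral_eq_sub_of_hasDerivAt
      (f := fun v => ((1+v)/2)^i * ((1-v)/2)^l * ((1-v)^(a+1) * (1+v)^(b+1)))]
    · simp [Real.zero_rpow (show a+1 ≠ 0 by linarith), Real.zero_rpow (show b+1 ≠ 0 by linarith)]
    · intro v hv
      rw [Set.uIcc_of_le (by norm_num)] at hv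
      have d1 : HasDerivAt (fun v : ℝ => (1+v)/2) (1/2) v := by
        simpa using ((hasDerivAt_id v).const_add 1).div_const 2
      have d2 : HasDerivAt (fun v : ℝ => (1-v)/2) (-1/2) v := by
        simpa using ((hasDerivAt_id v).const_sub 1).div_const 2
      have d3 : HasDerivAt (fun v : ℝ => (1+v)) 1 v := by
        simpa using ((hasDerivAt_id v).const_add 1)
      have d4 : HasDerivAt (fun v : ℝ => (1-v)) (-1) v := by
        simpa using ((hasDerivAt_id v).const_sub 1)
      have d5 := d4.rpow_const (p := a+1) (Or.inr (by linarith))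
      have d6 := d3.rpow_const (p := b+1) (Or.inr (by linarith))
      have d7 := ((d1.fun_pow i).fun_mul (d2.fun_pow l)).fun_mul (d5.fun_mul d6)
      refine d7.congr_deriv ?_
      have e1 : (1-v)^(a+1) = (1-v)^a*(1-v) := Real.rpow_add_one' (by linarith [hv.2]) (by linarith)
      have e2 : (1+v)^(b+1) = (1+v)^b*(1+v) := Real.rpow_add_one' (by linarith [hv.1]) (by linarith)
      rw [e1, e2, add_sub_cancel_right, add_sub_cancel_right]
      have e3 : (i:ℝ) * ((1+v)/2)^(i-1) * ((1+v)/2) = i * ((1+v)/2)^i := by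
        rcases i with _ | i
        · simp
        · simp [pow_succ]; ring
      have e4 : (l:ℝ) * ((1-v)/2)^(l-1) * ((1-v)/2) = l * ((1-v)/2)^l := by
        rcases l with _ | l
        · simp
        · simp [pow_succ]; ring
      unfold MI
      rw [pow_succ, pow_succ]
      linear_combination (((1-v)/2)^l * (1-v)^a*(1-v)*(1+v)^b) * e3 - (((1+v)/2)^i * (1-v)^a*(1+v)*(1+v)^b) * e4
    · apply Continuous.intervalIntegrable
      have := MI_cont a b ha hb i (l+1)
      have := MI_cont a b ha hb (i+1) l
      fun_prop
  rw [intervalIntegral.integral_const_mul, intervalIntegral.integral_sub,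
    intervalIntegral.integral_const_mul, intervalIntegral.integral_const_mul] at key
  · unfold MM; linarith
  · exact ((MI_cont a b ha hb _ _).const_mul _).intervalIntegrable _ _
  · exact ((MI_cont a b ha hb _ _).const_mul _).intervalIntegrable _ _

theorem MM_formula (a b : ℝ) (ha : 0 ≤ a) (hb : 0 ≤ b) (i l : ℕ) :
    poch (a+b+2) (i+l) * MM a b i l = poch (b+1) i * poch (a+1) l * MM a b 0 0 := by
  induction i generalizing l with
  | zero =>
    induction l with
    | zero => simp [poch_zero]
    | succ l ih =>
      have h1 := MM_add a b ha hb 0 l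
      have h2 := MM_parts a b ha hb 0 l
      rw [zero_add] at *
      rw [poch_succ, poch_succ]
      simp only [poch_zero] at *
      push_cast at *
      linear_combination (a+1+l) * ih + poch (a+b+2) l * ((a+1+l)*h1 - h2)
  | succ i ih =>
    have ih := ih l
    have h1 := MM_add a b ha hb i l
    have h2 := MM_parts a b ha hb i l
    rw [show i+1+l = i+l+1 by ring, poch_succ, poch_succ]
    push_cast at *
    linear_combination (b+1+i) * ih + poch (a+b+2) (i+l) * ((b+1+i)*h1 + h2)

theorem MM_pos (a b : ℝ) (ha : 0 ≤ a) (hb : 0 ≤ b) : 0 < MM a b 0 0 := by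
  apply intervalIntegral.intervalIntegral_pos_of_pos_on
  · exact (MI_cont a b ha hb _ _).intervalIntegrable _ _
  · intro v hv
    unfold MI
    have h1 : 0 < 1 - v := by linarith [hv.2]
    have h2 : 0 < 1 + v := by linarith [hv.1]
    positivity
  · norm_num

theorem int_expand (a b : ℝ) (ha : 0 ≤ a) (hb : 0 ≤ b) (n : ℕ) (u s : ℝ) :
    ∫ v in (-1:ℝ)..1, jacobiP n a b
                (1 - (1 - v ^ 2) * (1 - u) - 1/2 * (1 - v) ^ 2 * (1 - s)) *
              ((1 - v) ^ a * (1 + v) ^ b) =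
    ∑ j ∈ Finset.range (n+1), ∑ i ∈ Finset.range (j+1),
      (ww (a+1) n * ((poch (-(n : ℝ)) j * poch ((n : ℝ) + a + b + 1) j) /
        (poch (a + 1) j * (j.factorial : ℝ))) * (j.choose i) * (2*(1-u))^i * (1-s)^(j-i)) *
        MM a b i (j+(j-i)) := by
  have : ∀ v : ℝ, jacobiP n a b
                (1 - (1 - v ^ 2) * (1 - u) - 1/2 * (1 - v) ^ 2 * (1 - s)) *
              ((1 - v) ^ a * (1 + v) ^ b) =
     ∑ j ∈ Finset.range (n+1), ∑ i ∈ Finset.range (j+1),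
      (ww (a+1) n * ((poch (-(n : ℝ)) j * poch ((n : ℝ) + a + b + 1) j) /
        (poch (a + 1) j * (j.factorial : ℝ))) * (j.choose i) * (2*(1-u))^i * (1-s)^(j-i)) *
        MI a b i (j+(j-i)) v := by
    intro v
    unfold jacobiP
    rw [Finset.mul_sum, Finset.sum_mul]
    apply Finset.sum_congr rfl
    intro j _
    rw [show (1 - (1 - (1 - v ^ 2) * (1 - u) - 1/2 * (1 - v) ^ 2 * (1 - s)))/2 =
      ((1-v)/2) * ((2*(1-u)*((1+v)/2)) + (1-s)*((1-v)/2)) by ring, mul_pow, add_pow,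
      Finset.mul_sum, Finset.mul_sum, Finset.mul_sum, Finset.sum_mul]
    apply Finset.sum_congr rfl
    intro i _
    unfold MI ww
    rw [pow_add, mul_pow, mul_pow (1-s)]
    ring
  simp only [this]
  rw [intervalIntegral.integral_finsetSum]
  · apply Finset.sum_congr rfl
    intro j _
    rw [intervalIntegral.integral_finsetSum]
    · apply Finset.sum_congr rfl
      intro i _
      rw [intervalIntegral.integral_const_mul]; rfl
    · intro i _
      exact ((MI_cont a b ha hb _ _).const_mul _).intervalIntegrable _ _
  · intro j _
    apply Continuous.intervalIntegrable
    apply continuous_finsetSum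
    intro i _
    exact ((MI_cont a b ha hb _ _).const_mul _)

theorem rhs_eq (lam γ : ℝ) (hl : 0 ≤ lam) (hγ : -1 < γ) (n : ℕ) (u s : ℝ) :
    jacobiP n (lam+γ+1) lam 1 / hJ n (lam+γ+1) lam * ((MM (lam+γ+1) lam 0 0)⁻¹ *
      ∫ v in (-1:ℝ)..1, jacobiP n (lam+γ+1) lam
                (1 - (1 - v ^ 2) * (1 - u) - 1/2 * (1 - v) ^ 2 * (1 - s)) *
              ((1 - v) ^ (lam+γ+1) * (1 + v) ^ lam)) =
    poch (lam+γ+2) n / poch (lam+1) n * RR n lam γ s u := by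
  have ha : 0 ≤ lam+γ+1 := by linarith
  rw [int_expand _ _ ha hl, jacobi_one]
  unfold RR
  simp only [Finset.mul_sum]
  apply Finset.sum_congr rfl
  intro j hj
  have hj : j ≤ n := by simpa [Nat.lt_succ_iff] using hj
  apply Finset.sum_congr rfl
  intro i hi
  have hi : i ≤ j := by simpa [Nat.lt_succ_iff] using hi
  have hM := MM_pos _ _ ha hl
  have hF := MM_formula _ _ ha hl i (j+(j-i))
  obtain ⟨A, hA⟩ : ∃ A, A = γ+2*lam+2 := ⟨_, rfl⟩
  obtain ⟨c, hc⟩ : ∃ c, c = lam+γ+2 := ⟨_, rfl⟩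
  have hA0 : 0 < A := by linarith
  have hc0 : 0 < c := by linarith
  rw [← hA, ← hc]
  rw [show i+(j+(j-i)) = 2*j by omega, show lam+γ+1+lam+2 = A+1 by rw [hA]; ring,
    show lam+γ+1+1 = c by rw [hc]; ring] at hF
  unfold hJ
  rw [show lam+γ+1+lam+2 = A+1 by rw [hA]; ring, show lam+γ+1+1 = c by rw [hc]; ring,
    show (n:ℝ)+(lam+γ+1)+lam+1 = A+n by rw [hA]; ring,
    show lam+γ+1+lam+(n:ℝ)+1 = A+n by rw [hA]; ring,
    show lam+γ+1+lam+2*(n:ℝ)+1 = A+2*n by rw [hA]; ring, poch_neg_nat n j hj]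
  generalize MM (lam+γ+1) lam 0 0 = M0 at *
  have hp1 := (poch_pos (show 0 < A+1 by linarith) (2*j)).ne'
  have hMM : MM (lam+γ+1) lam i (j+(j-i)) = poch (lam+1) i * poch c (j+(j-i)) * M0 / poch (A+1) (2*j) := by
    field_simp; linarith
  rw [hMM]
  obtain ⟨r, rfl⟩ := Nat.exists_eq_add_of_le hi
  have hch : (((i+r).choose i : ℕ):ℝ) = ((i+r).factorial:ℝ)/((i.factorial:ℝ)*(r.factorial:ℝ)) := by
    have := Nat.choose_mul_factorial_mul_factorial hi
    rw [show i+r-i = r by omega] at this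
    rw [eq_div_iff (by positivity), ← this]; push_cast; ring
  rw [show i+r-i = r by omega, hch]
  have e1 := poch_add c (i+r) r
  have e2 := poch_succ_left A (2*(i+r))
  have e3 := poch_add A n (i+r)
  have e4 := poch_succ_left A n
  rw [poch_succ] at e4
  unfold KK ww
  rw [e1, e2, e3]
  have hp2 := (poch_pos hc0 n).ne'
  have hp3 := (poch_pos hc0 (i+r)).ne'
  have hp4 := (poch_pos (show 0 < lam+1 by linarith) n).ne'
  have hp5 := (poch_pos (show 0 < A+1 by linarith) n).ne'
  have hAn : A+n ≠ 0 := by positivity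
  have hAn2 : A+2*n ≠ 0 := by positivity
  have f1 := Nat.factorial_ne_zero n
  have f2 := Nat.factorial_ne_zero (n-(i+r))
  have f3 := Nat.factorial_ne_zero (i+r)
  have f4 := Nat.factorial_ne_zero i
  have f5 := Nat.factorial_ne_zero r
  have e4' : poch (A+1) n = poch A n * (A+n)/A := by field_simp; linarith
  rw [e4'] at hp5 ⊢
  have hp6 := (poch_pos hA0 n).ne'
  push_cast
  generalize poch (A+1) (2*(i+r)) = x1 at *
  generalize poch c (i+r) = x2 at *
  generalize poch (c+((i+r:ℕ):ℝ)) r = x3 at *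
  generalize poch c n = x4 at *
  generalize poch (lam+1) n = x5 at *
  generalize poch A n = x6 at *
  generalize poch (A+n) (i+r) = x7 at *
  generalize poch (lam+1) i = x8 at *
  generalize (2*(1-u))^i = y1 at *
  generalize (1-s)^r = y2 at *
  generalize (-1:ℝ)^(i+r) = y3 at *
  field_simp
  try ring

theorem sum_swap (f : ℕ → ℕ → ℝ) (n : ℕ) :
    ∑ N ∈ Finset.range (n+1), ∑ m ∈ Finset.range (N+1), f N m =
      ∑ m ∈ Finset.range (n+1), ∑ k ∈ Finset.range (n-m+1), f (m+k) m := by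
  induction n with
  | zero => simp
  | succ n ih =>
    rw [Finset.sum_range_succ, ih, Finset.sum_range_succ _ (n+1), Finset.sum_range_succ _ (n+1),
      ← add_assoc, ← Finset.sum_add_distrib]
    congr 1
    · apply Finset.sum_congr rfl
      intro m hm
      have hm : m ≤ n := by simpa [Nat.lt_succ_iff] using hm
      rw [show n+1-m+1 = (n-m+1)+1 by omega, Finset.sum_range_succ _ (n-m+1),
        show m+(n-m+1) = n+1 by omega]
    · simp

theorem cJ_pos (a b : ℝ) (ha : -1 < a) (hb : -1 < b) : 0 < cJ a b := by
  unfold cJ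
  have h1 := Real.Gamma_pos_of_pos (show 0 < a+b+2 by linarith)
  have h2 := Real.Gamma_pos_of_pos (show 0 < a+1 by linarith)
  have h3 := Real.Gamma_pos_of_pos (show 0 < b+1 by linarith)
  positivity

theorem cJ_shift (lam γ : ℝ) (hl : 0 ≤ lam) (hγ : -1 < γ) (m : ℕ) :
    cJ (m+lam) γ * poch (lam+1) m = cJ lam γ * poch (lam+γ+2) m := by
  induction m with
  | zero => simp [poch_zero]
  | succ m ih =>
    rw [poch_succ, poch_succ, ← mul_assoc (cJ lam γ), ← ih]
    unfold cJ
    have hm := Nat.cast_nonneg (α := ℝ) m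
    have h1 := Real.Gamma_add_one (s := m+lam+γ+2) (by linarith)
    have h2 := Real.Gamma_add_one (s := m+lam+1) (by linarith)
    have h4 := Real.Gamma_pos_of_pos (show 0 < m+lam+1 by linarith)
    have h5 := Real.Gamma_pos_of_pos (show 0 < γ+1 by linarith)
    have h6 : (m:ℝ)+lam+1 ≠ 0 := by linarith
    rw [show ((m+1:ℕ):ℝ)+lam+γ+2 = m+lam+γ+2+1 by push_cast; ring,
      show ((m+1:ℕ):ℝ)+lam+1 = m+lam+1+1 by push_cast; ring, h1, h2]
    generalize Real.Gamma (m+lam+γ+2) = x1 at *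
    generalize Real.Gamma (m+lam+1) = x2 at *
    generalize Real.Gamma (γ+1) = x3 at *
    field_simp
    ring

theorem lhs_eq (d : ℕ) (hd : 2 ≤ d) (γ lam : ℝ) (hlam : lam = ((d:ℝ)-2)/2) (hγ : -1 < γ) (n : ℕ)
    (s u : ℝ) :
    KnV0 d (-(1/2)) γ n 1 s (u/√s) = poch (lam+γ+2) n / poch (lam+1) n * LL n lam γ s u := by
  have hl : 0 ≤ lam := by
    have : (2:ℝ) ≤ d := by exact_mod_cast hd
    rw [hlam]; linarith
  unfold KnV0 PnV0
  rw [sum_swap, LL, Finset.mul_sum]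
  apply Finset.sum_congr rfl
  intro m hm
  have hm : m ≤ n := by simpa [Nat.lt_succ_iff] using hm
  have hm0 := Nat.cast_nonneg (α := ℝ) m
  have hc := cJ_shift lam γ hl hγ m
  have hp1 := (poch_pos (show 0 < lam+1 by linarith) m).ne'
  have hp2 := (poch_pos (show 0 < m+lam+1 by linarith) (n-m)).ne'
  have c1 := (cJ_pos lam γ (by linarith) hγ).ne'
  have c2 := (cJ_pos (m+lam) γ (by linarith) hγ).ne'
  have hcd := jacobi_CD (m+lam) γ s (by linarith) hγ (n-m)
  have e : ∀ k ∈ Finset.range (n-m+1),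
     jacobiP (m+k-m) ((m:ℝ)+(-(1/2))+((d:ℝ)-1)/2) γ (1-2*1) *
       jacobiP (m+k-m) ((m:ℝ)+(-(1/2))+((d:ℝ)-1)/2) γ (1-2*s) / hV0 d (-(1/2)) γ m (m+k) *
       √1^m * √s^m * Zm (((d:ℝ)-2)/2) m (u/√s) =
     (jacobiP k (m+lam) γ (1-2*1) * jacobiP k (m+lam) γ (1-2*s) / hJ k (m+lam) γ) *
      (poch (lam+γ+2) m / poch (lam+1) m * (√s^m * ZZ lam m (u/√s))) := by
    intro k _
    unfold hV0
    rw [show (m:ℝ)+(-(1/2))+((d:ℝ)-1)/2 = m+lam by rw [hlam]; ring,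
      show (-(1/2))+((d:ℝ)-1)/2 = lam by rw [hlam]; ring, ← hlam, Zm_eq lam hl,
      show m+k-m = k by omega, Real.sqrt_one, one_pow, mul_one]
    have hr : cJ (m+lam) γ / cJ lam γ = poch (lam+γ+2) m / poch (lam+1) m := by
      rw [div_eq_div_iff c1 hp1]; linarith
    rw [← hr, div_mul_eq_div_div, div_div_eq_mul_div]
    ring
  rw [Finset.sum_congr rfl e, ← Finset.sum_mul, hcd]
  have e1 := poch_add (lam+γ+2) m (n-m)
  have e2 := poch_add (lam+1) m (n-m)
  rw [show m+(n-m) = n by omega] at e1 e2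
  rw [e1, e2, show lam+γ+2+(m:ℝ) = m+lam+γ+2 by ring, show lam+1+(m:ℝ) = m+lam+1 by ring]
  field_simp

/-- closed formula for the partial-sum kernel `K_n(ϖ_{-1/2,γ}; (ξ,1), (y,s))`
on the surface of the paraboloid. -/
theorem stmt9 (d : ℕ) (hd : 2 ≤ d) (γ : ℝ) (hγ : -1 < γ) (n : ℕ)
    (ξ : Euc d) (hξ : ‖ξ‖ = 1) (y : Euc d) (s : ℝ) (hys : ‖y‖ ^ 2 = s)
    (hs0 : 0 < s) (hs1 : s ≤ 1) :
    KnV0 d (-(1/2)) γ n 1 s (⟪ξ, y⟫ / Real.sqrt s) =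
      jacobiP n (γ + (d : ℝ)/2) (((d : ℝ) - 2)/2) 1 /
          hJ n (γ + (d : ℝ)/2) (((d : ℝ) - 2)/2) *
        ((∫ v in (-1:ℝ)..1, (1 - v) ^ (γ + (d : ℝ)/2) * (1 + v) ^ (((d : ℝ) - 2)/2))⁻¹ *
          ∫ v in (-1:ℝ)..1,
            jacobiP n (γ + (d : ℝ)/2) (((d : ℝ) - 2)/2)
                (1 - (1 - v ^ 2) * (1 - ⟪ξ, y⟫) - 1/2 * (1 - v) ^ 2 * (1 - s)) *
              ((1 - v) ^ (γ + (d : ℝ)/2) * (1 + v) ^ (((d : ℝ) - 2)/2))) := by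

  obtain ⟨lam, hlam⟩ : ∃ lam, lam = ((d:ℝ)-2)/2 := ⟨_, rfl⟩
  have hl : 0 ≤ lam := by
    have : (2:ℝ) ≤ d := by exact_mod_cast hd
    rw [hlam]; linarith
  have h1 := rhs_eq lam γ hl hγ n ⟪ξ, y⟫ s
  rw [lhs_eq d hd γ lam hlam hγ n s, LL_eq_RR n lam γ s _ hl hγ hs0, ← h1, ← hlam,
    show γ + (d:ℝ)/2 = lam+γ+1 by rw [hlam]; ring]
  have h2 : MM (lam+γ+1) lam 0 0 = ∫ v in (-1:ℝ)..1, (1 - v) ^ (lam+γ+1) * (1 + v) ^ lam := by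
    unfold MM MI
    simp
  rw [h2]
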